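/- Let d ≥ 1, m ∈ ℝ, and a ∈ S^m_{1,1}. Then there is a constant C such that for every tempered distribution f with ‖f‖_{F_∞^{m,1}} < ∞, the limit T_a f := lim_{N→∞} Σ_{j=0}^{N} Σ_{k=0}^{N} T_{a_{j,k}} f converges in S′(ℝ^d), is represented by a locally integrable function, and satisfies ‖T_a f‖_{bmo} ≤ C ‖f‖_{F_∞^{m,1}}; that is, T_a maps F_∞^{m,1} into bmo (= F_∞^{0,2}). -/

import Mathlib

noncomputable section

open MeasureTheory SchwartzMap Complex RealInnerProductSpace Filter
open scoped ENNReal NNReal ContDiff SchwartzMap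

/-- Euclidean space `ℝ^d`. -/
abbrev RD (d : ℕ) : Type := EuclideanSpace ℝ (Fin d)

/-- Tempered distributions on `ℝ^d`. -/
abbrev TD (d : ℕ) : Type := 𝓢(RD d, ℂ) →L[ℂ] ℂ

/-- Fourier transform of a Schwartz function (with the convention
`f̂(ξ) = ∫ f(x) e^{-2πi⟨x,ξ⟩} dx`). -/
def fourierS {d : ℕ} (f : 𝓢(RD d, ℂ)) : 𝓢(RD d, ℂ) :=
  SchwartzMap.fourierTransformCLM ℂ f

/-- Hörmander symbol class `S^m_{1,1}`: `a` is smooth and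
`‖∂_ξ^α ∂_x^β a(x,ξ)‖ ≤ c_{α,β} (1+‖ξ‖)^{m-|α|+|β|}` for all orders of derivatives. -/
def IsSymbolS11 (d : ℕ) (m : ℝ) (a : RD d → RD d → ℂ) : Prop :=
  ContDiff ℝ ∞ (fun p : RD d × RD d => a p.1 p.2) ∧
  ∀ α β : ℕ, ∃ c : ℝ, ∀ x ξ : RD d,
    ‖iteratedFDeriv ℝ α (fun ξ' => iteratedFDeriv ℝ β (fun x' => a x' ξ') x) ξ‖
      ≤ c * (1 + ‖ξ‖) ^ (m - (α : ℝ) + (β : ℝ))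

/-- The pseudo-differential operator `T_a f(x) = ∫ a(x,ξ) f̂(ξ) e^{2πi⟨x,ξ⟩} dξ`
acting on a Schwartz function `f`. -/
def pdo {d : ℕ} (a : RD d → RD d → ℂ) (f : 𝓢(RD d, ℂ)) (x : RD d) : ℂ :=
  ∫ ξ, a x ξ * fourierS f ξ * Complex.exp (2 * Real.pi * Complex.I * ((⟪x, ξ⟫ : ℝ) : ℂ))

/-- Littlewood–Paley data: a Schwartz function `φ` with `φ̂` supported in
`{1/2 ≤ |ξ| ≤ 2}` and `Σ_{k∈ℤ} φ̂(2^{-k}ξ) = 1` for `ξ ≠ 0`, together with the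
low-frequency piece `Φ` determined by `Φ̂ = 1 - Σ_{k≥1} φ̂(2^{-k}·)`. -/
structure LPData (d : ℕ) where
  φ : 𝓢(RD d, ℂ)
  Φ : 𝓢(RD d, ℂ)
  supp_φ : ∀ ξ : RD d, fourierS φ ξ ≠ 0 → 1/2 ≤ ‖ξ‖ ∧ ‖ξ‖ ≤ 2
  sum_φ : ∀ ξ : RD d, ξ ≠ 0 → HasSum (fun k : ℤ => fourierS φ ((2:ℝ)^(-k) • ξ)) 1
  Φ_def : ∀ ξ : RD d, fourierS Φ ξ = 1 - ∑' k : ℕ, fourierS φ (((2:ℝ)^(k+1))⁻¹ • ξ)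

/-- The Littlewood–Paley convolution kernel: `Φ` for `k = 0` and
`φ_k = 2^{kd} φ(2^k ·)` for `k ≥ 1`. -/
def LPkernel {d : ℕ} (D : LPData d) : ℕ → RD d → ℂ
  | 0, x => D.Φ x
  | (k+1), x => (((2:ℝ)^((k+1) * d) : ℝ) : ℂ) * D.φ ((2:ℝ)^(k+1) • x)

/-- The Fourier transform of the `k`-th Littlewood–Paley kernel, i.e. `φ̂_k = φ̂(2^{-k}·)`
for `k ≥ 1` and `Φ̂` for `k = 0`. -/
def LPhat {d : ℕ} (D : LPData d) : ℕ → RD d → ℂ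
  | 0, ξ => fourierS D.Φ ξ
  | (k+1), ξ => fourierS D.φ (((2:ℝ)^(k+1))⁻¹ • ξ)

/-- Littlewood–Paley operator `Π_k g = φ_k ∗ g` (with `φ_0 := Φ`) acting on functions. -/
def LP {d : ℕ} (D : LPData d) (k : ℕ) (g : RD d → ℂ) (x : RD d) : ℂ :=
  ∫ y, LPkernel D k y * g (x - y)

/-- `Π*_k = Π_{k-1} + Π_k + Π_{k+1}` (with the convention `φ_{-1} := 0`). -/
def LPstar {d : ℕ} (D : LPData d) (k : ℕ) (g : RD d → ℂ) (x : RD d) : ℂ :=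
  (if k = 0 then 0 else LP D (k-1) g x) + LP D k g x + LP D (k+1) g x

open Classical in
/-- Pairing of a tempered distribution with a plain function: it gives `u ψ` if the
function is (the coercion of) a Schwartz function `ψ`, and `0` otherwise. -/
def pairing {d : ℕ} (u : TD d) (g : RD d → ℂ) : ℂ :=
  if h : ∃ ψ : 𝓢(RD d, ℂ), ⇑ψ = g then u h.choose else 0

/-- Fourier transform of a tempered distribution, `⟨û, ψ⟩ = ⟨u, ψ̂⟩`. -/
def fourierTD {d : ℕ} (u : TD d) : TD d :=
  u.comp (SchwartzMap.fourierTransformCLM ℂ)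

/-- Littlewood–Paley operator on tempered distributions:
`Π_k u (x) = ⟨u, φ_k(x - ·)⟩`. -/
def LPdist {d : ℕ} (D : LPData d) (k : ℕ) (u : TD d) (x : RD d) : ℂ :=
  pairing u (fun y => LPkernel D k (x - y))

/-- The symbol `a_{j,k}(x,ξ) = (φ_j ∗ a(·,ξ))(x) · φ̂_k(ξ)` (with `Φ` replacing `φ_0`). -/
def symbolPiece {d : ℕ} (D : LPData d) (a : RD d → RD d → ℂ) (j k : ℕ)
    (x ξ : RD d) : ℂ :=
  (∫ y, LPkernel D j y * a (x - y) ξ) * LPhat D k ξ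

/-- `T_{a_{j,k}} u (x) = ⟨û, a_{j,k}(x,·) e^{2πi⟨x,·⟩}⟩` for a tempered distribution `u`. -/
def pdoPieceD {d : ℕ} (D : LPData d) (a : RD d → RD d → ℂ) (j k : ℕ)
    (u : TD d) (x : RD d) : ℂ :=
  pairing (fourierTD u)
    (fun ξ => symbolPiece D a j k x ξ * Complex.exp (2 * Real.pi * Complex.I * ((⟪x, ξ⟫ : ℝ) : ℂ)))

/-- Partial sums `Σ_{j=0}^N Σ_{k=0}^N T_{a_{j,k}} u (x)`. -/
def pdoPartial {d : ℕ} (D : LPData d) (a : RD d → RD d → ℂ) (N : ℕ)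
    (u : TD d) (x : RD d) : ℂ :=
  ∑ j ∈ Finset.range (N+1), ∑ k ∈ Finset.range (N+1), pdoPieceD D a j k u x

/-- `T_a u` converges in `S'` to the tempered distribution `Tf`: the partial sums
`Σ_{j,k≤N} T_{a_{j,k}} u` (which are functions) converge to `Tf` weakly. -/
def ConvergesInSPrime {d : ℕ} (D : LPData d) (a : RD d → RD d → ℂ)
    (u : TD d) (Tf : TD d) : Prop :=
  ∀ ψ : 𝓢(RD d, ℂ),
    Tendsto (fun N => ∫ x, pdoPartial D a N u x * ψ x) atTop (nhds (Tf ψ))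

/-- The dyadic cube of level `ν` (side length `2^{-ν}`) indexed by `n ∈ ℤ^d`. -/
def dyadicCube (d : ℕ) (ν : ℤ) (n : Fin d → ℤ) : Set (RD d) :=
  {x | ∀ i, (n i : ℝ) * (2:ℝ)^(-ν) ≤ x i ∧ x i < ((n i : ℝ) + 1) * (2:ℝ)^(-ν)}

/-- The local quantity `(|P|⁻¹ ∫_P Σ_{k=k₀}^∞ 2^{skq} ‖g_k(x)‖^q dx)^{1/q}` for the
dyadic cube `P` of level `μ` indexed by `n` (so that `|P|⁻¹ = 2^{μd}`). -/
def cubePiece (d : ℕ) (μ : ℕ) (n : Fin d → ℤ) (k₀ : ℕ) (s q : ℝ)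
    (g : ℕ → RD d → ℂ) : ℝ≥0∞ :=
  ((2:ℝ≥0∞)^((μ:ℝ)*(d:ℝ)) *
    ∫⁻ x in dyadicCube d μ n,
      ∑' j : ℕ, (2:ℝ≥0∞)^(s*((k₀:ℝ)+(j:ℝ))*q) * (‖g (k₀+j) x‖₊ : ℝ≥0∞)^q) ^ (1/q)

/-- The `F_∞^{s,q}` norm (for `q < ∞`) of a function, computed from its
Littlewood–Paley pieces:
`‖Π_0 g‖_∞ + sup_{l(P)<1 dyadic} (|P|⁻¹ ∫_P Σ_{k=-log₂ l(P)}^∞ 2^{skq}|Π_k g|^q)^{1/q}`. -/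
def FinftyNormFun {d : ℕ} (D : LPData d) (s q : ℝ) (g : RD d → ℂ) : ℝ≥0∞ :=
  (⨆ x : RD d, (‖LP D 0 g x‖₊ : ℝ≥0∞)) +
  ⨆ (μ : ℕ) (_ : 1 ≤ μ) (n : Fin d → ℤ),
    cubePiece d μ n μ s q (fun k x => LP D k g x)

/-- The `F_∞^{s,q}` norm (for `q < ∞`) of a tempered distribution. -/
def FinftyNormDist {d : ℕ} (D : LPData d) (s q : ℝ) (u : TD d) : ℝ≥0∞ :=
  (⨆ x : RD d, (‖LPdist D 0 u x‖₊ : ℝ≥0∞)) +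
  ⨆ (μ : ℕ) (_ : 1 ≤ μ) (n : Fin d → ℤ),
    cubePiece d μ n μ s q (fun k x => LPdist D k u x)

/-- The (axis-parallel, closed) cube with corner `c` and side length `L`. -/
def cube (d : ℕ) (c : RD d) (L : ℝ) : Set (RD d) :=
  {x | ∀ i, c i ≤ x i ∧ x i ≤ c i + L}

/-- The average of `g` over the cube with corner `c` and side length `L`. -/
def cubeMean {d : ℕ} (c : RD d) (L : ℝ) (g : RD d → ℂ) : ℂ :=
  (L^d)⁻¹ • ∫ x in cube d c L, g x

/-- The `bmo` norm (local BMO):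
`sup_{l(Q)≥1} |Q|⁻¹∫_Q |g| + sup_{l(Q)<1} |Q|⁻¹∫_Q |g - g_Q|`, over all cubes `Q`. -/
def bmoNorm (d : ℕ) (g : RD d → ℂ) : ℝ≥0∞ :=
  (⨆ (c : RD d) (L : ℝ) (_ : 1 ≤ L),
    ENNReal.ofReal ((L^d)⁻¹) * ∫⁻ x in cube d c L, (‖g x‖₊ : ℝ≥0∞)) +
  (⨆ (c : RD d) (L : ℝ) (_ : 0 < L) (_ : L < 1),
    ENNReal.ofReal ((L^d)⁻¹) * ∫⁻ x in cube d c L, (‖g x - cubeMean c L g‖₊ : ℝ≥0∞))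

/-- The Peetre maximal function `𝔐_{σ,R} g(x) = sup_y ‖g(x-y)‖/(1+R‖y‖)^σ`. -/
def peetre {d : ℕ} (σ R : ℝ) (g : RD d → ℂ) (x : RD d) : ℝ≥0∞ :=
  ⨆ y : RD d, (‖g (x - y)‖₊ : ℝ≥0∞) / ENNReal.ofReal ((1 + R * ‖y‖) ^ σ)

/-- `g` has (distributional) Fourier support contained in `K`: the pairing
`⟨ĝ, ψ⟩ = ∫ g · ψ̂` vanishes for every Schwartz `ψ` whose support does not meet `K`. -/
def HasFourierSupportIn {d : ℕ} (g : RD d → ℂ) (K : Set (RD d)) : Prop :=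
  ∀ ψ : 𝓢(RD d, ℂ), tsupport ⇑ψ ∩ K = ∅ → ∫ x, g x * fourierS ψ x = 0

/-- Smooth dependence on a parameter under the integral sign: if all derivatives of `F z` are
locally dominated by integrable functions of `z`, then `∫ F z` is smooth and is differentiated under
the integral sign. -/
theorem contDiff_integral_of_dominated {V X G : Type*} [NormedAddCommGroup V] [NormedSpace ℝ V]
    [NormedAddCommGroup G] [NormedSpace ℝ G] [CompleteSpace G] [MeasurableSpace X] {ρ : Measure X}
    {F : X → V → G} (hF : ∀ z, ContDiff ℝ ∞ (F z))
    (hmeas : ∀ n y, AEStronglyMeasurable (fun z => iteratedFDeriv ℝ n (F z) y) ρ)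
    (hbound : ∀ (n : ℕ) (y₀ : V), ∃ b : X → ℝ, Integrable b ρ ∧
      ∀ z, ∀ y ∈ Metric.ball y₀ 1, ‖iteratedFDeriv ℝ n (F z) y‖ ≤ b z) :
    ContDiff ℝ ∞ (fun y => ∫ z, F z y ∂ρ) ∧
      ∀ n y, iteratedFDeriv ℝ n (fun y => ∫ z, F z y ∂ρ) y =
        ∫ z, iteratedFDeriv ℝ n (F z) y ∂ρ := by
  have hInt : ∀ n y, Integrable (fun z => iteratedFDeriv ℝ n (F z) y) ρ := by
    intro n y
    obtain ⟨b, hb, hle⟩ := hbound n y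
    exact hb.mono' (hmeas n y) (.of_forall fun z => hle z y (Metric.mem_ball_self one_pos))
  have hderiv : ∀ n y, HasFDerivAt (fun y => ∫ z, iteratedFDeriv ℝ n (F z) y ∂ρ)
      (∫ z, fderiv ℝ (iteratedFDeriv ℝ n (F z)) y ∂ρ) y := by
    intro n y
    obtain ⟨b, hb, hle⟩ := hbound (n + 1) y
    refine hasFDerivAt_integral_of_dominated_of_fderiv_le (𝕜 := ℝ) (bound := b)
      (F := fun y z => iteratedFDeriv ℝ n (F z) y)
      (F' := fun y z => fderiv ℝ (iteratedFDeriv ℝ n (F z)) y)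
      (Metric.ball_mem_nhds y one_pos) (.of_forall fun y => hmeas n y) (hInt n y) ?_ ?_ hb ?_
    · have := (continuousMultilinearCurryLeftEquiv ℝ (fun _ : Fin (n + 1) => V)
        G).continuous.comp_aestronglyMeasurable (hmeas (n + 1) y)
      refine this.congr (.of_forall fun z => ?_)
      simp [iteratedFDeriv_succ_eq_comp_left]
    · refine .of_forall fun z y hy => ?_
      rw [norm_fderiv_iteratedFDeriv]
      exact hle z y hy
    · refine .of_forall fun z y _ => ?_
      exact (((hF z).differentiable_iteratedFDeriv
        (by exact_mod_cast WithTop.coe_lt_top n)) y).hasFDerivAt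
  have heq : ∀ n y, iteratedFDeriv ℝ n (fun y => ∫ z, F z y ∂ρ) y =
      ∫ z, iteratedFDeriv ℝ n (F z) y ∂ρ := by
    intro n
    induction n with
    | zero =>
      intro y
      have := (continuousMultilinearCurryFin0 ℝ V G).symm.toContinuousLinearEquiv.integral_comp_comm (μ := ρ)
        (fun z => F z y)
      simpa [iteratedFDeriv_zero_eq_comp] using this.symm
    | succ n ih =>
      intro y
      have h1 : iteratedFDeriv ℝ n (fun y => ∫ z, F z y ∂ρ) =
          fun y => ∫ z, iteratedFDeriv ℝ n (F z) y ∂ρ := funext ih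
      have := ContinuousLinearEquiv.integral_comp_comm (𝕜 := ℝ) (F := V [×(n + 1)]→L[ℝ] G) (μ := ρ)
        (continuousMultilinearCurryLeftEquiv ℝ (fun _ : Fin (n + 1) => V)
          G).symm.toContinuousLinearEquiv (fun z => fderiv ℝ (iteratedFDeriv ℝ n (F z)) y)
      simp only [iteratedFDeriv_succ_eq_comp_left, Function.comp_apply, h1, (hderiv n y).fderiv]
      exact this.symm
  refine ⟨?_, heq⟩
  refine contDiff_of_differentiable_iteratedFDeriv (n := ⊤) fun n _ y => ?_
  rw [show iteratedFDeriv ℝ n (fun y => ∫ z, F z y ∂ρ) =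
          fun y => ∫ z, iteratedFDeriv ℝ n (F z) y ∂ρ from funext (heq n)]
  exact (hderiv n y).differentiableAt

/-- A linear functional dominated by `‖ι x‖` factors through a continuous functional
of `ι x` (Hahn–Banach). -/
theorem exists_continuousLinearMap_comp_eq {X E : Type*} [AddCommGroup X] [Module ℂ X]
    [NormedAddCommGroup E] [NormedSpace ℂ E] (ι : X →ₗ[ℂ] E) (u : X →ₗ[ℂ] ℂ) (C : ℝ)
    (hb : ∀ x, ‖u x‖ ≤ C * ‖ι x‖) : ∃ U : E →L[ℂ] ℂ, ∀ x, u x = U (ι x) := by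
  have hker : LinearMap.ker ι ≤ LinearMap.ker u := by
    intro x hx
    rw [LinearMap.mem_ker] at hx ⊢
    have := hb x
    rw [hx, norm_zero, mul_zero] at this
    exact norm_le_zero_iff.1 this
  let f₀ : LinearMap.range ι →ₗ[ℂ] ℂ :=
    (LinearMap.ker ι).liftQ u hker ∘ₗ ι.quotKerEquivRange.symm.toLinearMap
  have hf₀ : ∀ x, f₀ ⟨ι x, LinearMap.mem_range_self ι x⟩ = u x := by
    intro x
    simp [f₀, LinearMap.quotKerEquivRange_symm_apply_image]
  obtain ⟨U, hU, -⟩ := exists_extension_norm_eq (LinearMap.range ι)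
    (f₀.mkContinuous C (by
      rintro ⟨_, x, rfl⟩
      rw [hf₀]
      exact hb x))
  refine ⟨U, fun x => ?_⟩
  rw [← hf₀ x]
  exact (hU ⟨ι x, LinearMap.mem_range_self ι x⟩).symm

/-- Multilinear maps, the values of iterated derivatives. -/
abbrev JetFiber (d n : ℕ) : Type := RD d [×n]→L[ℝ] ℂ

instance (d n : ℕ) : NormedAddCommGroup (JetFiber d n) := inferInstance

instance (d n : ℕ) : NormedSpace ℂ (JetFiber d n) := inferInstance

/-- The weighted derivative `y ↦ ‖y‖^k D^n ψ(y)` of a Schwartz function, `i = (k, n)`, as a bounded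
continuous function. -/
def schwartzJet (d : ℕ) (i : ℕ × ℕ) :
    𝓢(RD d, ℂ) →ₗ[ℂ] BoundedContinuousFunction (RD d) (JetFiber d i.2) where
  toFun ψ := BoundedContinuousFunction.ofNormedAddCommGroup
    (fun y => ‖y‖ ^ i.1 • iteratedFDeriv ℝ i.2 ψ y)
    ((continuous_norm.pow _).smul ((ψ.smooth ⊤).continuous_iteratedFDeriv (by exact_mod_cast le_top)))
    (SchwartzMap.seminorm ℝ i.1 i.2 ψ) (fun y => by
      rw [norm_smul, norm_pow, norm_norm]
      exact ψ.le_seminorm ℝ i.1 i.2 y)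
  map_add' ψ₁ ψ₂ := by
    ext1 y
    have h1 : ContDiffAt ℝ i.2 ψ₁ y := (ψ₁.smooth i.2).contDiffAt
    have h2 : ContDiffAt ℝ i.2 ψ₂ y := (ψ₂.smooth i.2).contDiffAt
    have : iteratedFDeriv ℝ i.2 (⇑(ψ₁ + ψ₂)) y =
        iteratedFDeriv ℝ i.2 ψ₁ y + iteratedFDeriv ℝ i.2 ψ₂ y := iteratedFDeriv_add_apply h1 h2
    change ‖y‖ ^ i.1 • iteratedFDeriv ℝ i.2 (⇑(ψ₁ + ψ₂)) y = ‖y‖ ^ i.1 • iteratedFDeriv ℝ i.2 ψ₁ y +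
      ‖y‖ ^ i.1 • iteratedFDeriv ℝ i.2 ψ₂ y
    rw [this, smul_add]
  map_smul' c ψ := by
    ext1 y
    have h1 : ContDiffAt ℝ i.2 ψ y := (ψ.smooth i.2).contDiffAt
    have : iteratedFDeriv ℝ i.2 (⇑(c • ψ)) y = c • iteratedFDeriv ℝ i.2 ψ y :=
      iteratedFDeriv_const_smul_apply h1
    change ‖y‖ ^ i.1 • iteratedFDeriv ℝ i.2 (⇑(c • ψ)) y = c • (‖y‖ ^ i.1 • iteratedFDeriv ℝ i.2 ψ y)
    rw [this, smul_comm]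

theorem schwartzJet_apply {d : ℕ} (i : ℕ × ℕ) (ψ : 𝓢(RD d, ℂ)) (y : RD d) :
    schwartzJet d i ψ y = ‖y‖ ^ i.1 • iteratedFDeriv ℝ i.2 ψ y := rfl

theorem seminorm_le_norm_schwartzJet {d : ℕ} (i : ℕ × ℕ) (ψ : 𝓢(RD d, ℂ)) :
    SchwartzMap.seminorm ℂ i.1 i.2 ψ ≤ ‖schwartzJet d i ψ‖ := by
  refine SchwartzMap.seminorm_le_bound ℂ _ _ _ (norm_nonneg _) fun y => ?_
  have := (schwartzJet d i ψ).norm_coe_le_norm y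
  rwa [schwartzJet_apply, norm_smul, norm_pow, norm_norm] at this


/-- A tempered distribution factors through finitely many weighted derivatives. -/
theorem exists_eq_comp_schwartzJet {d : ℕ} (u : TD d) :
    ∃ (S : Finset (ℕ × ℕ))
      (U : ((i : S) → BoundedContinuousFunction (RD d) (JetFiber d i.1.2)) →L[ℂ] ℂ),
      ∀ ψ, u ψ = U (fun i => schwartzJet d i ψ) := by
  obtain ⟨S, C, -, hC⟩ := Seminorm.bound_of_continuous (schwartz_withSeminorms ℂ (RD d) ℂ)
    ((normSeminorm ℂ ℂ).comp u.toLinearMap) (continuous_norm.comp u.continuous)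
  let ι : 𝓢(RD d, ℂ) →ₗ[ℂ]
      ((i : S) → BoundedContinuousFunction (RD d) (JetFiber d i.1.2)) :=
    LinearMap.pi fun i => schwartzJet d i
  obtain ⟨U, hU⟩ := exists_continuousLinearMap_comp_eq ι u.toLinearMap C (fun ψ => by
    refine (hC ψ).trans ?_
    simp only [smul_apply, NNReal.smul_def, smul_eq_mul]
    refine mul_le_mul_of_nonneg_left ?_ C.2
    refine Seminorm.finset_sup_apply_le (norm_nonneg _) fun i hi => ?_
    exact (seminorm_le_norm_schwartzJet i ψ).trans (norm_le_pi_norm (ι ψ) ⟨i, hi⟩))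
  exact ⟨S, U, hU⟩

theorem iteratedFDeriv_compSubConstCLM {d : ℕ} (ψ : 𝓢(RD d, ℂ)) (n : ℕ) (z y : RD d) :
    iteratedFDeriv ℝ n (compSubConstCLM ℂ z ψ) y = iteratedFDeriv ℝ n ψ (y - z) := by
  have : ⇑(compSubConstCLM ℂ z ψ) = fun y => ψ (y - z) := by
    ext y; simp
  rw [this, iteratedFDeriv_comp_sub]

theorem exists_pow_mul_norm_iteratedFDeriv_sub_le {d : ℕ} (ψ : 𝓢(RD d, ℂ)) (k n : ℕ) :
    ∃ C : ℝ, 0 ≤ C ∧ ∀ y z : RD d,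
      ‖y‖ ^ k * ‖iteratedFDeriv ℝ n ψ (y - z)‖ ≤ C * (1 + ‖z‖) ^ k := by
  refine ⟨2 ^ k * ((Finset.Iic (k, n)).sup fun m => SchwartzMap.seminorm ℂ m.1 m.2) ψ,
    by positivity, fun y z => ?_⟩
  have h1 := SchwartzMap.one_add_le_sup_seminorm_apply (𝕜 := ℂ) (m := (k, n)) le_rfl le_rfl ψ (y - z)
  have h2 : ‖y‖ ≤ (1 + ‖y - z‖) * (1 + ‖z‖) := by
    have : ‖y‖ ≤ ‖y - z‖ + ‖z‖ := by simpa using norm_add_le (y - z) z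
    nlinarith [norm_nonneg (y - z), norm_nonneg z]
  calc ‖y‖ ^ k * ‖iteratedFDeriv ℝ n ψ (y - z)‖
      ≤ ((1 + ‖y - z‖) * (1 + ‖z‖)) ^ k * ‖iteratedFDeriv ℝ n ψ (y - z)‖ := by gcongr
    _ = ((1 + ‖y - z‖) ^ k * ‖iteratedFDeriv ℝ n ψ (y - z)‖) * (1 + ‖z‖) ^ k := by
        rw [mul_pow]; ring
    _ ≤ _ := by gcongr

theorem exists_norm_schwartzJet_translate_le {d : ℕ} (ψ : 𝓢(RD d, ℂ)) (i : ℕ × ℕ) :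
    ∃ C : ℝ, 0 ≤ C ∧ ∀ z : RD d,
      ‖schwartzJet d i (compSubConstCLM ℂ z ψ)‖ ≤ C * (1 + ‖z‖) ^ i.1 := by
  obtain ⟨C, hC, h⟩ := exists_pow_mul_norm_iteratedFDeriv_sub_le ψ i.1 i.2
  refine ⟨C, hC, fun z => (BoundedContinuousFunction.norm_le (by positivity)).2 fun y => ?_⟩
  rw [schwartzJet_apply, norm_smul, norm_pow, norm_norm, iteratedFDeriv_compSubConstCLM]
  exact h y z

theorem continuous_schwartzJet_translate {d : ℕ} (ψ : 𝓢(RD d, ℂ)) (i : ℕ × ℕ) :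
    Continuous fun z : RD d => schwartzJet d i (compSubConstCLM ℂ z ψ) := by
  obtain ⟨C, hC, h⟩ := exists_pow_mul_norm_iteratedFDeriv_sub_le ψ i.1 (i.2 + 1)
  rw [continuous_iff_continuousAt]
  intro z₀
  set R : ℝ := ‖z₀‖ + 1
  have hlip : LipschitzOnWith (Real.toNNReal (C * (1 + R) ^ i.1))
      (fun z : RD d => schwartzJet d i (compSubConstCLM ℂ z ψ)) (Metric.closedBall 0 R) := by
    refine LipschitzOnWith.of_dist_le_mul fun z hz z' hz' => ?_
    rw [Real.coe_toNNReal _ (by positivity)]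
    refine (BoundedContinuousFunction.dist_le (by positivity)).2 fun y => ?_
    rw [schwartzJet_apply, schwartzJet_apply, iteratedFDeriv_compSubConstCLM,
      iteratedFDeriv_compSubConstCLM]
    have hder : ∀ w ∈ Metric.closedBall (0 : RD d) R,
        HasFDerivWithinAt (fun w => ‖y‖ ^ i.1 • iteratedFDeriv ℝ i.2 ψ (y - w))
          (‖y‖ ^ i.1 • (fderiv ℝ (iteratedFDeriv ℝ i.2 ψ) (y - w)).comp
            (-(ContinuousLinearMap.id ℝ (RD d)))) (Metric.closedBall 0 R) w := by
      intro w _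
      have h1 : HasFDerivAt (iteratedFDeriv ℝ i.2 ψ)
          (fderiv ℝ (iteratedFDeriv ℝ i.2 ψ) (y - w)) (y - w) :=
        (((ψ.smooth ⊤).differentiable_iteratedFDeriv
          (by exact_mod_cast WithTop.coe_lt_top i.2)) _).hasFDerivAt
      have h2 : HasFDerivAt (fun w : RD d => y - w) (-(ContinuousLinearMap.id ℝ (RD d))) w :=
        (hasFDerivAt_id w).const_sub y
      exact ((h1.comp w h2).const_smul (‖y‖ ^ i.1)).hasFDerivWithinAt
    have := Convex.norm_image_sub_le_of_norm_hasFDerivWithin_le (C := C * (1 + R) ^ i.1) hder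
      (fun w hw => ?_) (convex_closedBall 0 R) hz' hz
    · simpa [dist_eq_norm] using this
    · rw [norm_smul, norm_pow, norm_norm]
      have hw' : ‖w‖ ≤ R := by simpa using hw
      have h3 : ‖(fderiv ℝ (iteratedFDeriv ℝ i.2 ψ) (y - w)).comp
          (-(ContinuousLinearMap.id ℝ (RD d)))‖ ≤ ‖iteratedFDeriv ℝ (i.2 + 1) ψ (y - w)‖ := by
        rw [← norm_fderiv_iteratedFDeriv]
        simp
      calc _ ≤ ‖y‖ ^ i.1 * ‖iteratedFDeriv ℝ (i.2 + 1) ψ (y - w)‖ := by gcongr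
        _ ≤ C * (1 + ‖w‖) ^ i.1 := h y w
        _ ≤ _ := by gcongr
  refine hlip.continuousOn.continuousAt ?_
  refine Metric.closedBall_mem_nhds_of_mem ?_
  simp [R]

theorem continuous_apply_translate {d : ℕ} (u : TD d) (ψ : 𝓢(RD d, ℂ)) :
    Continuous fun z : RD d => u (compSubConstCLM ℂ z ψ) := by
  obtain ⟨S, U, hU⟩ := exists_eq_comp_schwartzJet u
  simp_rw [hU]
  exact U.continuous.comp (continuous_pi fun i => continuous_schwartzJet_translate ψ i)

theorem integrable_one_add_norm_pow_mul_schwartz {d : ℕ} (g : 𝓢(RD d, ℂ)) (k : ℕ) :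
    Integrable fun z : RD d => (1 + ‖z‖) ^ k * ‖g z‖ := by
  have h : ∀ z : RD d, (1 + ‖z‖) ^ k * ‖g z‖ =
      ∑ i ∈ Finset.range (k + 1), (k.choose i : ℝ) * (‖z‖ ^ i * ‖g z‖) := by
    intro z
    rw [add_comm 1 ‖z‖, add_pow, Finset.sum_mul]
    exact Finset.sum_congr rfl fun i _ => by simp; ring
  simp_rw [h]
  refine integrable_finsetSum _ fun i _ => Integrable.const_mul ?_ _
  exact g.integrable_pow_mul volume i

/-- Derivatives of a convolution of Schwartz functions. -/
theorem iteratedFDeriv_integral_mul_translate {d : ℕ} (g ψ : 𝓢(RD d, ℂ)) (n : ℕ) (y : RD d) :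
    iteratedFDeriv ℝ n (fun y => ∫ z, g z * ψ (y - z)) y =
      ∫ z, g z • iteratedFDeriv ℝ n ψ (y - z) := by
  have hF : ∀ (n : ℕ) (z y : RD d), iteratedFDeriv ℝ n (fun y => g z * ψ (y - z)) y =
      g z • iteratedFDeriv ℝ n ψ (y - z) := by
    intro n z y
    have h1 : (fun y => g z * ψ (y - z)) = fun y => g z • (fun y => ψ (y - z)) y := by
      ext y; simp
    have h2 : ContDiff ℝ n (fun y => ψ (y - z)) := (ψ.smooth n).comp (contDiff_id.sub contDiff_const)
    rw [h1, iteratedFDeriv_const_smul_apply' h2.contDiffAt, iteratedFDeriv_comp_sub]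
  have hsm : ∀ z, ContDiff ℝ ∞ (fun y => g z * ψ (y - z)) := fun z =>
    contDiff_const.mul ((ψ.smooth ⊤).comp (contDiff_id.sub contDiff_const))
  have := (contDiff_integral_of_dominated (ρ := volume) hsm (fun n y => ?_) (fun n y₀ => ?_)).2 n y
  · simpa only [hF] using this
  · simp only [hF]
    refine Continuous.aestronglyMeasurable ?_
    exact g.continuous.smul (((ψ.smooth ⊤).continuous_iteratedFDeriv
      (by exact_mod_cast le_top)).comp (continuous_const.sub continuous_id))
  · refine ⟨fun z => ‖g z‖ * SchwartzMap.seminorm ℝ 0 n ψ, ?_, fun z y _ => ?_⟩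
    · exact g.integrable.norm.mul_const _
    · rw [hF, norm_smul]
      refine mul_le_mul_of_nonneg_left ?_ (norm_nonneg _)
      simpa using ψ.le_seminorm ℝ 0 n (y - z)

/-- A tempered distribution commutes with convolution integrals. -/
theorem apply_eq_integral_translate {d : ℕ} (u : TD d) (g ψ Θ : 𝓢(RD d, ℂ))
    (hΘ : ∀ y, Θ y = ∫ z, g z * ψ (y - z)) :
    u Θ = ∫ z, g z * u (compSubConstCLM ℂ z ψ) := by
  obtain ⟨S, U, hU⟩ := exists_eq_comp_schwartzJet u
  have hinti : ∀ i : S, Integrable fun z : RD d =>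
      g z • schwartzJet d i (compSubConstCLM ℂ z ψ) := by
    intro i
    obtain ⟨C, hC, h⟩ := exists_norm_schwartzJet_translate_le ψ i
    refine ((integrable_one_add_norm_pow_mul_schwartz g i.1.1).const_mul C).mono'
      (g.continuous.smul (continuous_schwartzJet_translate ψ i)).aestronglyMeasurable
      (Eventually.of_forall fun z => ?_)
    rw [norm_smul]
    calc _ ≤ ‖g z‖ * (C * (1 + ‖z‖) ^ i.1.1) := by gcongr; exact h z
      _ = _ := by ring
  have hInt : Integrable fun z : RD d => g z • (fun i : S =>
      schwartzJet d i (compSubConstCLM ℂ z ψ)) := Integrable.of_eval hinti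
  have hkey : (fun i : S => schwartzJet d i Θ) = ∫ z, g z • (fun i : S =>
      schwartzJet d i (compSubConstCLM ℂ z ψ)) := by
    funext i
    refine Eq.trans ?_ (eval_integral hinti i).symm
    ext1 y
    have h1 := (BoundedContinuousFunction.evalCLM ℝ y :
      BoundedContinuousFunction (RD d) (JetFiber d i.1.2) →L[ℝ] _).integral_comp_comm (hinti i)
    simp only [BoundedContinuousFunction.evalCLM_apply] at h1
    rw [← h1, schwartzJet_apply]
    have h2 : ⇑Θ = fun y => ∫ z, g z * ψ (y - z) := funext hΘ
    rw [h2, iteratedFDeriv_integral_mul_translate, ← integral_smul]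
    refine integral_congr_ae (Eventually.of_forall fun z => ?_)
    simp only [BoundedContinuousFunction.coe_smul, schwartzJet_apply,
      iteratedFDeriv_compSubConstCLM]
    exact smul_comm _ _ _
  rw [hU, hkey, ← U.integral_comp_comm hInt]
  simp_rw [hU, map_smul, smul_eq_mul]

/-- The `L¹`-normalised dyadic dilation `2^{Nd} f(2^N ·)`. -/
def scaleS {d : ℕ} (N : ℕ) (f : 𝓢(RD d, ℂ)) : 𝓢(RD d, ℂ) :=
  (((2:ℝ)^(N * d) : ℝ) : ℂ) • compCLMOfContinuousLinearEquiv ℂ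
    (ContinuousLinearEquiv.smulLeft (R₁ := ℝ) (M₁ := RD d)
      (Units.mk0 ((2:ℝ)^N) (by positivity))) f

theorem scaleS_apply {d : ℕ} (N : ℕ) (f : 𝓢(RD d, ℂ)) (x : RD d) :
    scaleS N f x = (((2:ℝ)^(N * d) : ℝ) : ℂ) * f ((2:ℝ)^N • x) := rfl

theorem fourierS_apply {d : ℕ} (f : 𝓢(RD d, ℂ)) (ξ : RD d) :
    fourierS f ξ = ∫ v, Real.fourierChar (-⟪v, ξ⟫) • f v := rfl

theorem integral_scaleS_mul {d : ℕ} (N : ℕ) (f : 𝓢(RD d, ℂ)) (G : RD d → ℂ) :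
    ∫ x, scaleS N f x * G x = ∫ x, f x * G (((2:ℝ)^N)⁻¹ • x) := by
  have h := Measure.integral_comp_smul (volume : Measure (RD d))
    (fun x => f x * G (((2:ℝ)^N)⁻¹ • x)) ((2:ℝ)^N)
  have h2 : (((2:ℝ)^N)^d)  ≠ 0 := by positivity
  simp only [finrank_euclideanSpace, Fintype.card_fin] at h
  rw [abs_of_pos (by positivity)] at h
  simp only [scaleS_apply, mul_assoc]
  rw [integral_const_mul]
  have h3 : ∀ x : RD d, ((2:ℝ)^N)⁻¹ • (2:ℝ)^N • x = x := fun x =>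
    inv_smul_smul₀ (by positivity) x
  simp only [h3] at h
  rw [h, pow_mul, Complex.real_smul, ← mul_assoc, ← Complex.ofReal_mul, mul_inv_cancel₀ h2]
  simp

theorem fourierS_scaleS {d : ℕ} (N : ℕ) (f : 𝓢(RD d, ℂ)) (ξ : RD d) :
    fourierS (scaleS N f) ξ = fourierS f (((2:ℝ)^N)⁻¹ • ξ) := by
  rw [fourierS_apply, fourierS_apply]
  have h := integral_scaleS_mul N f (fun v => (Real.fourierChar (-⟪v, ξ⟫) : ℂ))
  simp only [Circle.smul_def, smul_eq_mul]
  simp only [mul_comm _ (f _), mul_comm _ (scaleS N f _)]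
  rw [h]
  simp only [real_inner_smul_left, real_inner_smul_right]

theorem fourierS_injective {d : ℕ} : Function.Injective (fourierS (d := d)) := by
  intro f g h
  have h' : FourierTransform.fourier f = FourierTransform.fourier g := h
  have := congrArg FourierTransformInv.fourierInv h'
  simpa using this

/-- The Littlewood–Paley kernel as a Schwartz function. -/
def LPkernelS {d : ℕ} (D : LPData d) : ℕ → 𝓢(RD d, ℂ)
  | 0 => D.Φ
  | k + 1 => scaleS (k + 1) D.φ

theorem LPkernelS_apply {d : ℕ} (D : LPData d) (k : ℕ) (x : RD d) :
    LPkernelS D k x = LPkernel D k x := by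
  cases k <;> rfl

theorem fourierS_LPkernelS {d : ℕ} (D : LPData d) (k : ℕ) (ξ : RD d) :
    fourierS (LPkernelS D k) ξ = LPhat D k ξ := by
  cases k
  · rfl
  · exact fourierS_scaleS _ _ _

theorem LPData.summable_dilates {d : ℕ} (D : LPData d) (ξ : RD d) :
    Summable fun k : ℕ => fourierS D.φ (((2:ℝ)^(k+1))⁻¹ • ξ) := by
  by_cases hξ : ξ = 0
  · have : ∀ k : ℕ, fourierS D.φ (((2:ℝ)^(k+1))⁻¹ • ξ) = 0 := by
      intro k
      by_contra h
      have := (D.supp_φ _ h).1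
      simp [hξ] at this
      norm_num at this
    simp_rw [this]
    exact summable_zero
  · have := (D.sum_φ ξ hξ).summable.comp_injective
      (i := fun k : ℕ => (k : ℤ) + 1) (fun a b h => by simpa using h)
    refine this.congr fun k => ?_
    simp only [Function.comp]
    rw [zpow_neg]
    norm_cast

theorem LPhat_zero_dilate {d : ℕ} (D : LPData d) (N : ℕ) (ξ : RD d) :
    fourierS D.Φ (((2:ℝ)^N)⁻¹ • ξ) = ∑ j ∈ Finset.range (N + 1), LPhat D j ξ := by
  rw [D.Φ_def, Finset.sum_range_succ']
  have h := (D.summable_dilates ξ).sum_add_tsum_nat_add N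
  have h2 : ∀ k : ℕ, fourierS D.φ (((2:ℝ)^(k+1))⁻¹ • ((2:ℝ)^N)⁻¹ • ξ) =
      fourierS D.φ (((2:ℝ)^(k+N+1))⁻¹ • ξ) := by
    intro k
    rw [smul_smul, ← mul_inv, ← pow_add]
    congr 4
    ring
  simp_rw [h2]
  have h3 : LPhat D 0 ξ = _ := D.Φ_def ξ
  rw [h3, ← h]
  simp only [LPhat]
  ring

theorem sum_LPkernelS {d : ℕ} (D : LPData d) (N : ℕ) :
    ∑ j ∈ Finset.range (N + 1), LPkernelS D j = scaleS N D.Φ := by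
  apply fourierS_injective
  ext ξ
  have : fourierS (∑ j ∈ Finset.range (N + 1), LPkernelS D j) =
      ∑ j ∈ Finset.range (N + 1), fourierS (LPkernelS D j) := map_sum _ _ _
  rw [this, fourierS_scaleS, LPhat_zero_dilate, sum_apply]
  exact Finset.sum_congr rfl fun j _ => fourierS_LPkernelS D j ξ

theorem LPData.integral_Φ {d : ℕ} (D : LPData d) : ∫ x, D.Φ x = 1 := by
  have h := D.Φ_def 0
  have h0 : ∀ k : ℕ, fourierS D.φ (((2:ℝ)^(k+1))⁻¹ • (0 : RD d)) = 0 := by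
    intro k
    by_contra h
    have := (D.supp_φ _ h).1
    norm_num at this
  simp only [h0, tsum_zero, sub_zero] at h
  rw [← h, fourierS_apply]
  simp

theorem LPhat_zero_eq_zero {d : ℕ} (D : LPData d) (ξ : RD d) (hξ : 2 < ‖ξ‖) : LPhat D 0 ξ = 0 := by
  have hne : ξ ≠ 0 := by
    rintro rfl
    norm_num at hξ
  change fourierS D.Φ ξ = 0
  have h := D.sum_φ ξ hne
  have hinj : Function.Injective (fun k : ℕ => (k : ℤ) + 1) := fun a b h => by simpa using h
  rw [← hinj.hasSum_iff] at h
  · rw [D.Φ_def, sub_eq_zero, ← h.tsum_eq]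
    refine tsum_congr fun k => ?_
    simp only [Function.comp]
    rw [zpow_neg]
    norm_cast
  · intro k hk
    by_contra h0
    have h2 := (D.supp_φ _ h0).2
    have hk0 : k ≤ 0 := by
      by_contra hk'
      push Not at hk'
      exact hk ⟨(k - 1).toNat, by simp; omega⟩
    rw [norm_smul, Real.norm_of_nonneg (by positivity)] at h2
    have : (1:ℝ) ≤ 2 ^ (-k) := one_le_zpow₀ (by norm_num) (by omega)
    nlinarith

theorem LPhat_succ_support {d : ℕ} (D : LPData d) (k : ℕ) (ξ : RD d) (h : LPhat D (k + 1) ξ ≠ 0) :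
    1 / 2 ≤ ‖((2:ℝ)^(k+1))⁻¹ • ξ‖ ∧ ‖((2:ℝ)^(k+1))⁻¹ • ξ‖ ≤ 2 :=
  D.supp_φ _ h

/-- Littlewood–Paley pieces of a distribution through the reflected kernel. -/
theorem exists_reflection {d : ℕ} (ψ : 𝓢(RD d, ℂ)) : ∃ ψ' : 𝓢(RD d, ℂ), ∀ y, ψ' y = ψ (-y) :=
  ⟨compCLMOfContinuousLinearEquiv ℂ (ContinuousLinearEquiv.neg ℝ) ψ, fun _ => rfl⟩

theorem pairing_eq {d : ℕ} (u : TD d) (ψ : 𝓢(RD d, ℂ)) (g : RD d → ℂ) (h : ∀ y, ψ y = g y) :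
    pairing u g = u ψ := by
  have hex : ∃ ψ : 𝓢(RD d, ℂ), ⇑ψ = g := ⟨ψ, funext h⟩
  unfold _root_.pairing
  rw [dif_pos hex]
  congr 1
  apply DFunLike.coe_injective
  rw [hex.choose_spec]
  exact (funext h).symm

theorem LPdist_eq {d : ℕ} (D : LPData d) (k : ℕ) (u : TD d) (ψ : 𝓢(RD d, ℂ))
    (hψ : ∀ y, ψ y = LPkernelS D k (-y)) (z : RD d) :
    LPdist D k u z = u (compSubConstCLM ℂ z ψ) := by
  apply pairing_eq
  intro y
  rw [compSubConstCLM_apply, hψ, LPkernelS_apply]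
  simp

theorem continuous_LPdist {d : ℕ} (D : LPData d) (k : ℕ) (u : TD d) :
    Continuous (LPdist D k u) := by
  obtain ⟨ψ, hψ⟩ := exists_reflection (LPkernelS D k)
  rw [funext (LPdist_eq D k u ψ hψ)]
  exact continuous_apply_translate u ψ

/-- A bump equal to `1` on the ball of radius `2`, supported in the ball of radius `4`. -/
def outerBump (d : ℕ) : ContDiffBump (0 : RD d) := ⟨2, 4, by norm_num, by norm_num⟩

/-- A bump equal to `1` on the ball of radius `1/4`, supported in the ball of radius `1/2`. -/
def innerBump (d : ℕ) : ContDiffBump (0 : RD d) := ⟨1 / 4, 1 / 2, by norm_num, by norm_num⟩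

/-- Smooth frequency cutoffs: a ball cutoff for `k = 0`, an annulus cutoff for `k ≥ 1`. -/
def cutBump (d : ℕ) : ℕ → RD d → ℂ
  | 0, η => (outerBump d η : ℂ)
  | _ + 1, η => (outerBump d η : ℂ) - (innerBump d η : ℂ)

theorem contDiff_cutBump (d k : ℕ) : ContDiff ℝ ∞ (cutBump d k) := by
  have h1 : ContDiff ℝ ∞ fun η => (outerBump d η : ℂ) :=
    Complex.ofRealCLM.contDiff.comp (outerBump d).contDiff
  have h2 : ContDiff ℝ ∞ fun η => (innerBump d η : ℂ) :=
    Complex.ofRealCLM.contDiff.comp (innerBump d).contDiff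
  cases k
  · exact h1
  · exact h1.sub h2

theorem cutBump_eq_zero_of_le {d : ℕ} (k : ℕ) (η : RD d) (h : 4 ≤ ‖η‖) : cutBump d k η = 0 := by
  have h1 : outerBump d η = 0 := (outerBump d).zero_of_le_dist (by
    rw [dist_zero_right]
    exact h)
  have h2 : innerBump d η = 0 := (innerBump d).zero_of_le_dist (by
    simp only [dist_zero_right]
    exact le_trans (by norm_num [innerBump]) h)
  cases k <;> simp [cutBump, h1, h2]

theorem cutBump_succ_eq_zero_of_lt {d : ℕ} (k : ℕ) (η : RD d) (h : ‖η‖ ≤ 1 / 4) :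
    cutBump d (k + 1) η = 0 := by
  have h1 : outerBump d η = 1 := (outerBump d).one_of_mem_closedBall (by
    simp only [mem_closedBall_zero_iff]
    exact h.trans (by norm_num [outerBump]))
  have h2 : innerBump d η = 1 := (innerBump d).one_of_mem_closedBall (by
    rw [mem_closedBall_zero_iff]
    exact h)
  simp [cutBump, h1, h2]

theorem tsupport_cutBump_subset (d k : ℕ) : tsupport (cutBump d k) ⊆ Metric.closedBall 0 4 := by
  refine closure_minimal (fun η hη => ?_) Metric.isClosed_closedBall
  rw [mem_closedBall_zero_iff]
  by_contra h
  exact hη (cutBump_eq_zero_of_le k η (not_le.1 h).le)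

theorem tsupport_cutBump_succ_subset (d k : ℕ) :
    tsupport (cutBump d (k + 1)) ⊆ {η | 1 / 4 ≤ ‖η‖} := by
  refine closure_minimal (fun η hη => ?_) (isClosed_le continuous_const continuous_norm)
  by_contra h
  exact hη (cutBump_succ_eq_zero_of_lt k η (not_le.1 h).le)

theorem hasCompactSupport_cutBump (d k : ℕ) : HasCompactSupport (cutBump d k) :=
  (isCompact_closedBall 0 4).of_isClosed_subset (isClosed_tsupport _) (tsupport_cutBump_subset d k)

theorem cutBump_mul_LPhat {d : ℕ} (D : LPData d) (k : ℕ) (ξ : RD d) :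
    cutBump d k (((2:ℝ)^k)⁻¹ • ξ) * LPhat D k ξ = LPhat D k ξ := by
  by_cases h : LPhat D k ξ = 0
  · simp [h]
  cases k with
  | zero =>
    have h1 : ‖ξ‖ ≤ 2 := by
      by_contra h'
      exact h (LPhat_zero_eq_zero D ξ (not_le.1 h'))
    have h2 : outerBump d ξ = 1 := (outerBump d).one_of_mem_closedBall (by
      simpa [outerBump] using h1)
    simp [cutBump, h2]
  | succ k =>
    obtain ⟨h1, h2⟩ := LPhat_succ_support D k ξ h
    have h3 : outerBump d (((2:ℝ)^(k+1))⁻¹ • ξ) = 1 := (outerBump d).one_of_mem_closedBall (by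
      rw [mem_closedBall_zero_iff]
      exact h2)
    have h4 : innerBump d (((2:ℝ)^(k+1))⁻¹ • ξ) = 0 := (innerBump d).zero_of_le_dist (by
      rw [dist_zero_right]
      exact h1)
    simp [cutBump, h3, h4]

theorem exists_norm_iteratedFDeriv_cutBump_le (d n : ℕ) :
    ∃ C : ℝ, 0 ≤ C ∧ ∀ k η, ‖iteratedFDeriv ℝ n (cutBump d k) η‖ ≤ C := by
  have h : ∀ k, ∃ C, ∀ η, ‖iteratedFDeriv ℝ n (cutBump d k) η‖ ≤ C := fun k =>
    ((hasCompactSupport_cutBump d k).iteratedFDeriv n).exists_bound_of_continuous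
      ((contDiff_cutBump d k).continuous_iteratedFDeriv (by exact_mod_cast le_top))
  obtain ⟨C0, h0⟩ := h 0
  obtain ⟨C1, h1⟩ := h 1
  refine ⟨max C0 C1, (norm_nonneg _).trans ((h0 0).trans (le_max_left _ _)), fun k η => ?_⟩
  cases k with
  | zero => exact (h0 η).trans (le_max_left _ _)
  | succ k => exact (h1 η).trans (le_max_right _ _)

/-- Decay of the Fourier transform, and of its derivative, of a function supported in a fixed
ball. -/
theorem exists_fourier_decay (d L : ℕ) : ∃ C : ℝ, 0 ≤ C ∧ ∀ (β : RD d → ℂ) (B : ℝ), 0 ≤ B →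
    ContDiff ℝ ∞ β → tsupport β ⊆ Metric.closedBall 0 4 →
    (∀ n ≤ L, ∀ η, ‖iteratedFDeriv ℝ n β η‖ ≤ B) → ∀ i ≤ 1, ∀ w,
      (1 + ‖w‖) ^ L * ‖iteratedFDeriv ℝ i (FourierTransform.fourier β) w‖ ≤ C * B := by
  set V : ℝ := volume.real (Metric.closedBall (0 : RD d) 4)
  have hV : 0 ≤ V := measureReal_nonneg
  set Q : ℕ → ℕ → ℝ := fun i n => (2 * Real.pi) ^ i * (2 * (i : ℝ) + 2) ^ n *
    ∑ p ∈ Finset.range (i + 1) ×ˢ Finset.range (n + 1), 4 ^ p.1 * V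
  have hQ : ∀ i n, 0 ≤ Q i n := fun i n => by positivity
  refine ⟨2 ^ (L - 1) * ((Q 0 0 + Q 0 L) + (Q 1 0 + Q 1 L)), by
    have := hQ 0 0; have := hQ 0 L; have := hQ 1 0; have := hQ 1 L; positivity,
    fun β B hB hβ hsupp hb i hi w => ?_⟩
  have hz : ∀ n η, η ∉ Metric.closedBall (0 : RD d) 4 → iteratedFDeriv ℝ n β η = 0 := by
    intro n η hη
    by_contra h
    exact hη (hsupp (support_iteratedFDeriv_subset n h))
  have hcs : HasCompactSupport β :=
    (isCompact_closedBall 0 4).of_isClosed_subset (isClosed_tsupport _) hsupp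
  have hInt : ∀ k n : ℕ, Integrable fun v : RD d => ‖v‖ ^ k * ‖iteratedFDeriv ℝ n β v‖ := by
    intro k n
    refine Continuous.integrable_of_hasCompactSupport ?_ ?_
    · exact (continuous_norm.pow k).mul
        (hβ.continuous_iteratedFDeriv (by exact_mod_cast le_top)).norm
    · exact (hcs.iteratedFDeriv (𝕜 := ℝ) n).norm.mul_left
  have hle : ∀ k n : ℕ, n ≤ L → ∫ v : RD d, ‖v‖ ^ k * ‖iteratedFDeriv ℝ n β v‖ ≤ 4 ^ k * V * B := by
    intro k n hn
    calc ∫ v : RD d, ‖v‖ ^ k * ‖iteratedFDeriv ℝ n β v‖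
        ≤ ∫ v : RD d, (Metric.closedBall (0 : RD d) 4).indicator (fun _ => 4 ^ k * B) v := by
          refine integral_mono (hInt k n) ?_ fun v => ?_
          · exact (integrable_indicator_iff Metric.isClosed_closedBall.measurableSet).2
              (integrableOn_const (by
                exact (isCompact_closedBall (0 : RD d) 4).measure_lt_top.ne))
          · by_cases hv : v ∈ Metric.closedBall (0 : RD d) 4
            · rw [Set.indicator_of_mem hv]
              have : ‖v‖ ≤ 4 := by simpa using hv
              exact mul_le_mul (pow_le_pow_left₀ (norm_nonneg _) this k) (hb n hn v)
                (norm_nonneg _) (by positivity)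
            · simp [Set.indicator_of_notMem hv, hz n v hv]
      _ = 4 ^ k * V * B := by
          rw [integral_indicator Metric.isClosed_closedBall.measurableSet, setIntegral_const]
          simp only [smul_eq_mul, V]
          ring
  have hmain : ∀ n ≤ L, ‖w‖ ^ n * ‖iteratedFDeriv ℝ i (FourierTransform.fourier β) w‖ ≤ Q i n * B := by
    intro n hn
    refine (Real.pow_mul_norm_iteratedFDeriv_fourier_le (K := ⊤) (N := ⊤) hβ
      (fun k n _ _ => hInt k n) (k := i) (n := n) le_top le_top w).trans ?_
    simp only [Q]
    rw [mul_assoc _ _ B, Finset.sum_mul]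
    refine mul_le_mul_of_nonneg_left (Finset.sum_le_sum fun p hp => ?_) (by positivity)
    rw [Finset.mem_product, Finset.mem_range, Finset.mem_range] at hp
    exact hle p.1 p.2 (by omega)
  have hQi : Q i 0 + Q i L ≤ (Q 0 0 + Q 0 L) + (Q 1 0 + Q 1 L) := by
    have := hQ 0 0; have := hQ 0 L; have := hQ 1 0; have := hQ 1 L
    interval_cases i <;> linarith
  have h1 := hmain 0 (Nat.zero_le _)
  have h2 := hmain L le_rfl
  rw [pow_zero, one_mul] at h1
  calc _ ≤ (2 ^ (L - 1) * (1 ^ L + ‖w‖ ^ L)) *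
        ‖iteratedFDeriv ℝ i (FourierTransform.fourier β) w‖ := by
        gcongr
        exact add_pow_le zero_le_one (norm_nonneg _) L
    _ ≤ 2 ^ (L - 1) * ((Q i 0 + Q i L) * B) := by
        rw [one_pow, mul_assoc]
        refine mul_le_mul_of_nonneg_left ?_ (by positivity)
        linarith
    _ ≤ _ := by
        rw [mul_assoc]
        gcongr

/-- The convolution kernel of the multiplier `b` localised to frequencies of size `2^k`. -/
def cutKernel {d : ℕ} (k : ℕ) (b : RD d → ℂ) (w : RD d) : ℂ :=
  ∫ ξ, b ξ * cutBump d k (((2:ℝ)^k)⁻¹ • ξ) * (Real.fourierChar ⟪w, ξ⟫ : ℂ)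

/-- The weight `2^{kd} (1 + 2^k ‖w‖)^{-L}`. -/
def decayWeight {d : ℕ} (L k : ℕ) (w : RD d) : ℝ :=
  (2:ℝ)^(k * d) * ((1 + (2:ℝ)^k * ‖w‖) ^ L)⁻¹

theorem decayWeight_nonneg {d : ℕ} (L k : ℕ) (w : RD d) : 0 ≤ decayWeight L k w := by
  unfold decayWeight
  positivity

theorem cutKernel_eq_fourier {d : ℕ} (k : ℕ) (b : RD d → ℂ) (w : RD d) :
    cutKernel k b w = (((2:ℝ)^(k * d) : ℝ) : ℂ) *
      FourierTransform.fourier (fun η => cutBump d k η * b ((2:ℝ)^k • η)) (-((2:ℝ)^k • w)) := by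
  have h := Measure.integral_comp_smul (volume : Measure (RD d))
    (fun ξ => b ξ * cutBump d k (((2:ℝ)^k)⁻¹ • ξ) * (Real.fourierChar ⟪w, ξ⟫ : ℂ)) ((2:ℝ)^k)
  have h2 : (((2:ℝ)^k)^d)  ≠ 0 := by positivity
  simp only [finrank_euclideanSpace, Fintype.card_fin] at h
  rw [abs_of_pos (by positivity)] at h
  have h3 : ∀ x : RD d, ((2:ℝ)^k)⁻¹ • (2:ℝ)^k • x = x := fun x =>
    inv_smul_smul₀ (by positivity) x
  simp only [h3] at h
  have h4 : FourierTransform.fourier (fun η => cutBump d k η * b ((2:ℝ)^k • η)) (-((2:ℝ)^k • w)) =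
      ∫ ξ, b ((2:ℝ)^k • ξ) * cutBump d k ξ * (Real.fourierChar ⟪w, (2:ℝ)^k • ξ⟫ : ℂ) := by
    rw [Real.fourier_eq]
    refine integral_congr_ae (Eventually.of_forall fun η => ?_)
    simp only [Circle.smul_def, smul_eq_mul, inner_neg_right, real_inner_smul_right, neg_neg,
      real_inner_comm w η]
    ring
  rw [h4, h, pow_mul, Complex.real_smul, ← mul_assoc, ← Complex.ofReal_mul, mul_inv_cancel₀ h2]
  simp [cutKernel]

theorem rpow_le_five_rpow_abs {X Y s : ℝ} (hY : 0 < Y) (h1 : Y / 5 ≤ X) (h2 : X ≤ 5 * Y) :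
    X ^ s ≤ (5:ℝ) ^ |s| * Y ^ s := by
  have hX : 0 < X := lt_of_lt_of_le (by positivity) h1
  rcases le_total 0 s with hs | hs
  · rw [abs_of_nonneg hs, ← Real.mul_rpow (by norm_num) hY.le]
    exact Real.rpow_le_rpow hX.le h2 hs
  · rw [abs_of_nonpos hs]
    calc X ^ s ≤ (Y / 5) ^ s := Real.rpow_le_rpow_of_nonpos (by positivity) h1 hs
      _ = _ := by
        rw [Real.div_rpow hY.le (by norm_num), Real.rpow_neg (by norm_num)]
        field_simp

/-- A symbol of order `s` localised to frequencies of size `2^k` and rescaled to unit size. -/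
theorem exists_norm_iteratedFDeriv_cutBump_mul_le (d L : ℕ) (s : ℝ) (c : ℕ → ℝ) :
    ∃ C : ℝ, 0 ≤ C ∧ ∀ (k : ℕ) (b : RD d → ℂ) (M : ℝ), 0 ≤ M → ContDiff ℝ ∞ b →
      (∀ n ξ, ‖iteratedFDeriv ℝ n b ξ‖ ≤ c n * M * (1 + ‖ξ‖) ^ (s - n)) →
      ∀ n ≤ L, ∀ η, ‖iteratedFDeriv ℝ n (fun η => cutBump d k η * b ((2:ℝ)^k • η)) η‖ ≤
        C * (M * ((2:ℝ)^k) ^ s) := by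
  choose A hA hA' using exists_norm_iteratedFDeriv_cutBump_le d
  set R : ℕ → ℝ := fun n => ∑ i ∈ Finset.range (n + 1),
    (n.choose i : ℝ) * A i * (|c (n - i)| * (5:ℝ) ^ |s - ((n - i : ℕ) : ℝ)|)
  have hR : ∀ n, 0 ≤ R n := fun n => Finset.sum_nonneg fun i _ => by
    have := hA i
    positivity
  refine ⟨∑ n ∈ Finset.range (L + 1), R n, Finset.sum_nonneg fun n _ => hR n,
    fun k b M hM hb hbd n hn η => ?_⟩
  have hp : (0:ℝ) < 2 ^ k := by positivity
  have hsc : ∀ n, iteratedFDeriv ℝ n (fun η => b ((2:ℝ)^k • η)) η =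
      ((2:ℝ)^k) ^ n • iteratedFDeriv ℝ n b ((2:ℝ)^k • η) := fun n =>
    congrFun (iteratedFDeriv_comp_const_smul _ (hb.of_le (by exact_mod_cast le_top))) η
  have hbs : ContDiff ℝ ∞ fun η => b ((2:ℝ)^k • η) := hb.comp (contDiff_const_smul _)
  have key : ∀ i ≤ n, ‖iteratedFDeriv ℝ i (cutBump d k) η‖ *
      ‖iteratedFDeriv ℝ (n - i) (fun η => b ((2:ℝ)^k • η)) η‖ ≤
      A i * (|c (n - i)| * (5:ℝ) ^ |s - ((n - i : ℕ) : ℝ)|) * (M * ((2:ℝ)^k) ^ s) := by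
    intro i _
    by_cases hη : η ∈ tsupport (cutBump d k)
    · set j := n - i
      have h4 : ‖η‖ ≤ 4 := by simpa using tsupport_cutBump_subset d k hη
      have hup : 1 + ‖(2:ℝ)^k • η‖ ≤ 5 * 2 ^ k := by
        rw [norm_smul, Real.norm_of_nonneg hp.le]
        have : (1:ℝ) ≤ 2 ^ k := one_le_pow₀ (by norm_num)
        nlinarith
      have hlow : (2:ℝ)^k / 5 ≤ 1 + ‖(2:ℝ)^k • η‖ := by
        rw [norm_smul, Real.norm_of_nonneg hp.le]
        cases k with
        | zero => simp; nlinarith [norm_nonneg η]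
        | succ k =>
          have : 1 / 4 ≤ ‖η‖ := tsupport_cutBump_succ_subset d k hη
          nlinarith
      have h5 := rpow_le_five_rpow_abs (s := s - (j : ℝ)) hp hlow hup
      have h6 : ((2:ℝ)^k) ^ j * ((2:ℝ)^k) ^ (s - (j : ℝ)) = ((2:ℝ)^k) ^ s := by
        rw [← Real.rpow_natCast ((2:ℝ)^k) j, ← Real.rpow_add hp]
        congr 1; ring
      have h7 : ‖iteratedFDeriv ℝ j (fun η => b ((2:ℝ)^k • η)) η‖ ≤
          |c j| * (5:ℝ) ^ |s - (j : ℝ)| * (M * ((2:ℝ)^k) ^ s) := by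
        rw [hsc, norm_smul, Real.norm_of_nonneg (by positivity)]
        calc _ ≤ ((2:ℝ)^k) ^ j * (|c j| * M * ((5:ℝ) ^ |s - (j : ℝ)| *
              ((2:ℝ)^k) ^ (s - (j : ℝ)))) := by
              refine mul_le_mul_of_nonneg_left ((hbd j _).trans ?_) (by positivity)
              refine mul_le_mul (mul_le_mul_of_nonneg_right (le_abs_self _) hM) h5
                (by positivity) (by positivity)
          _ = |c j| * (5:ℝ) ^ |s - (j : ℝ)| * (M * (((2:ℝ)^k) ^ j *
              ((2:ℝ)^k) ^ (s - (j : ℝ)))) := by ring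
          _ = _ := by rw [h6]
      calc _ ≤ A i * (|c j| * (5:ℝ) ^ |s - (j : ℝ)| * (M * ((2:ℝ)^k) ^ s)) :=
            mul_le_mul (hA' i k η) h7 (norm_nonneg _) (hA i)
        _ = _ := by ring
    · have : iteratedFDeriv ℝ i (cutBump d k) η = 0 := by
        by_contra h
        exact hη (support_iteratedFDeriv_subset i h)
      rw [this, norm_zero, zero_mul]
      have := hA i
      positivity
  calc _ ≤ ∑ i ∈ Finset.range (n + 1), (n.choose i : ℝ) * ‖iteratedFDeriv ℝ i (cutBump d k) η‖ *
        ‖iteratedFDeriv ℝ (n - i) (fun η => b ((2:ℝ)^k • η)) η‖ :=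
        norm_iteratedFDeriv_mul_le (contDiff_cutBump d k) hbs η (by exact_mod_cast le_top)
    _ ≤ R n * (M * ((2:ℝ)^k) ^ s) := by
        simp only [R]
        rw [Finset.sum_mul]
        refine Finset.sum_le_sum fun i hi => ?_
        have := key i (by simpa [Nat.lt_succ_iff] using hi)
        calc _ = (n.choose i : ℝ) * (‖iteratedFDeriv ℝ i (cutBump d k) η‖ *
              ‖iteratedFDeriv ℝ (n - i) (fun η => b ((2:ℝ)^k • η)) η‖) := by ring
          _ ≤ (n.choose i : ℝ) * (A i * (|c (n - i)| * (5:ℝ) ^ |s - ((n - i : ℕ) : ℝ)|) *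
              (M * ((2:ℝ)^k) ^ s)) := by gcongr
          _ = _ := by ring
    _ ≤ _ := by
        refine mul_le_mul_of_nonneg_right ?_ (by positivity)
        exact Finset.single_le_sum (f := R) (fun n _ => hR n) (by simpa [Nat.lt_succ_iff] using hn)

theorem contDiff_cutBump_mul {d : ℕ} (k : ℕ) {b : RD d → ℂ} (hb : ContDiff ℝ ∞ b) :
    ContDiff ℝ ∞ (fun η => cutBump d k η * b ((2:ℝ)^k • η)) :=
  (contDiff_cutBump d k).mul (hb.comp (contDiff_const_smul _))

theorem tsupport_cutBump_mul_subset {d : ℕ} (k : ℕ) (b : RD d → ℂ) :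
    tsupport (fun η => cutBump d k η * b ((2:ℝ)^k • η)) ⊆ Metric.closedBall 0 4 :=
  (tsupport_mul_subset_left (f := cutBump d k) (g := fun η => b ((2:ℝ)^k • η))).trans
    (tsupport_cutBump_subset d k)

/-- Size and regularity of the kernel of a localised symbol of order `s`. -/
theorem exists_norm_cutKernel_le (d L : ℕ) (s : ℝ) (c : ℕ → ℝ) :
    ∃ C : ℝ, 0 ≤ C ∧ ∀ (k : ℕ) (b : RD d → ℂ) (M : ℝ), 0 ≤ M → ContDiff ℝ ∞ b →
      (∀ n ξ, ‖iteratedFDeriv ℝ n b ξ‖ ≤ c n * M * (1 + ‖ξ‖) ^ (s - n)) →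
      (∀ w, ‖cutKernel k b w‖ ≤ C * M * ((2:ℝ)^k) ^ s * decayWeight L k w) ∧
      ∀ w w' ρ, 2 ^ k * ‖w - w'‖ ≤ ρ → ‖cutKernel k b w - cutKernel k b w'‖ ≤
        C * M * ((2:ℝ)^k) ^ s * (1 + ρ) ^ L * (2 ^ k * ‖w - w'‖) * decayWeight L k w := by
  obtain ⟨C₁, hC₁, h₁⟩ := exists_norm_iteratedFDeriv_cutBump_mul_le d L s c
  obtain ⟨C₂, hC₂, h₂⟩ := exists_fourier_decay d L
  refine ⟨C₂ * C₁, by positivity, fun k b M hM hb hbd => ?_⟩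
  set β : RD d → ℂ := fun η => cutBump d k η * b ((2:ℝ)^k • η) with hβ
  have hp : (0:ℝ) < 2 ^ k := by positivity
  set B : ℝ := C₁ * (M * ((2:ℝ)^k) ^ s) with hB
  have hB0 : 0 ≤ B := by positivity
  have hF := h₂ β B hB0 (contDiff_cutBump_mul k hb) (tsupport_cutBump_mul_subset k b)
    (h₁ k b M hM hb hbd)
  have hF0 : ∀ v, ‖FourierTransform.fourier β v‖ ≤ C₂ * B * ((1 + ‖v‖) ^ L)⁻¹ := by
    intro v
    have := hF 0 zero_le_one v
    rw [norm_iteratedFDeriv_zero] at this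
    rw [← div_eq_mul_inv, le_div_iff₀ (by positivity)]
    linarith
  have hF1 : ∀ v, ‖fderiv ℝ (FourierTransform.fourier β) v‖ ≤ C₂ * B * ((1 + ‖v‖) ^ L)⁻¹ := by
    intro v
    have := hF 1 le_rfl v
    rw [show (1:ℕ) = 0 + 1 from rfl, ← norm_fderiv_iteratedFDeriv] at this
    have h0 : fderiv ℝ (iteratedFDeriv ℝ 0 (FourierTransform.fourier β)) v =
      ((continuousMultilinearCurryFin0 ℝ (RD d) ℂ).symm : ℂ →L[ℝ] _) ∘L
        fderiv ℝ (FourierTransform.fourier β) v := by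
      rw [iteratedFDeriv_zero_eq_comp]
      exact LinearIsometryEquiv.comp_fderiv _
    have h1 : ‖fderiv ℝ (iteratedFDeriv ℝ 0 (FourierTransform.fourier β)) v‖ =
        ‖fderiv ℝ (FourierTransform.fourier β) v‖ := by
      rw [h0]
      exact LinearIsometry.norm_toContinuousLinearMap_comp
        ((continuousMultilinearCurryFin0 ℝ (RD d) ℂ).symm.toLinearIsometry)
    rw [h1] at this
    rw [← div_eq_mul_inv, le_div_iff₀ (by positivity)]
    linarith
  have hdiff : Differentiable ℝ (FourierTransform.fourier β) := by
    have hcs : HasCompactSupport β :=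
      (isCompact_closedBall 0 4).of_isClosed_subset (isClosed_tsupport _)
        (tsupport_cutBump_mul_subset k b)
    have hcont : Continuous β := (contDiff_cutBump_mul k hb).continuous
    refine Real.differentiable_fourier (hcont.integrable_of_hasCompactSupport hcs) ?_
    exact (continuous_norm.mul hcont.norm).integrable_of_hasCompactSupport hcs.norm.mul_left
  refine ⟨fun w => ?_, fun w w' ρ hρ => ?_⟩
  · rw [cutKernel_eq_fourier, norm_mul, Complex.norm_real, Real.norm_of_nonneg (by positivity)]
    have := hF0 (-((2:ℝ)^k • w))
    rw [norm_neg, norm_smul, Real.norm_of_nonneg hp.le] at this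
    calc _ ≤ (2:ℝ)^(k * d) * (C₂ * B * ((1 + 2 ^ k * ‖w‖) ^ L)⁻¹) := by gcongr
      _ = _ := by rw [decayWeight, hB]; ring
  · rw [cutKernel_eq_fourier, cutKernel_eq_fourier, ← mul_sub, norm_mul, Complex.norm_real,
      Real.norm_of_nonneg (by positivity)]
    set v := -((2:ℝ)^k • w)
    set v' := -((2:ℝ)^k • w')
    have hv : ‖v‖ = 2 ^ k * ‖w‖ := by
      simp only [v]; rw [norm_neg, norm_smul, Real.norm_of_nonneg hp.le]
    have hvv : ‖v - v'‖ = 2 ^ k * ‖w - w'‖ := by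
      have : v - v' = -((2:ℝ)^k • (w - w')) := by simp only [v, v', smul_sub]; abel
      rw [this, norm_neg, norm_smul, Real.norm_of_nonneg hp.le]
    have hρ0 : 0 ≤ ρ := le_trans (by positivity) hρ
    have hmv : ‖FourierTransform.fourier β v - FourierTransform.fourier β v'‖ ≤
        C₂ * B * ((1 + ρ) ^ L * ((1 + ‖v‖) ^ L)⁻¹) * ‖v - v'‖ := by
      refine Convex.norm_image_sub_le_of_norm_fderiv_le (𝕜 := ℝ) (s := Metric.closedBall v ρ)
        (fun x _ => hdiff x) (fun x hx => ?_) (convex_closedBall v ρ) ?_ ?_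
      · refine (hF1 x).trans (mul_le_mul_of_nonneg_left ?_ (by positivity))
        rw [← div_eq_mul_inv, le_div_iff₀ (by positivity), ← div_eq_inv_mul,
          div_le_iff₀ (by positivity), ← mul_pow]
        gcongr
        have h1 : ‖v‖ ≤ ‖x‖ + ρ := by
          rw [mem_closedBall_iff_norm] at hx
          have := norm_sub_norm_le v x
          rw [norm_sub_rev] at this
          linarith
        nlinarith [norm_nonneg x]
      · rw [mem_closedBall_iff_norm, norm_sub_rev, hvv]
        exact hρ
      · exact Metric.mem_closedBall_self hρ0
    calc _ ≤ (2:ℝ)^(k * d) * (C₂ * B * ((1 + ρ) ^ L * ((1 + ‖v‖) ^ L)⁻¹) * ‖v - v'‖) := by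
            gcongr
      _ = _ := by rw [hv, hvv, decayWeight, hB]; ring

theorem contDiff_iteratedFDeriv_param {P V G : Type*} [NormedAddCommGroup P] [NormedSpace ℝ P]
    [NormedAddCommGroup V] [NormedSpace ℝ V] [NormedAddCommGroup G] [NormedSpace ℝ G]
    {f : P → V → G} (hf : ContDiff ℝ ∞ fun p : P × V => f p.1 p.2) (n : ℕ) :
    ContDiff ℝ ∞ fun p : P × V => iteratedFDeriv ℝ n (f p.1) p.2 := by
  induction n with
  | zero =>
    simp only [iteratedFDeriv_zero_eq_comp]
    exact (continuousMultilinearCurryFin0 ℝ V G).symm.contDiff.comp hf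
  | succ n ih =>
    simp only [iteratedFDeriv_succ_eq_comp_left]
    have h1 : ContDiff ℝ ∞ fun p : P × V => fderiv ℝ (iteratedFDeriv ℝ n (f p.1)) p.2 :=
      ContDiff.fderiv (f := fun (p : P × V) (v : V) => iteratedFDeriv ℝ n (f p.1) v)
        (n := ∞) (m := ∞)
        (ih.comp ((contDiff_fst.comp contDiff_fst).prodMk contDiff_snd)) contDiff_snd (by rfl)
    exact (LinearIsometryEquiv.contDiff (𝕜 := ℝ) (E := V →L[ℝ] (V [×n]→L[ℝ] G))
      (F := V [×(n + 1)]→L[ℝ] G)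
      (continuousMultilinearCurryLeftEquiv ℝ (fun _ : Fin (n + 1) => V) G).symm).comp h1

theorem rpow_le_rpow_abs {X Y s : ℝ} (h1 : 1 ≤ X) (h2 : X ≤ Y) : X ^ s ≤ Y ^ |s| := by
  calc X ^ s ≤ X ^ |s| := Real.rpow_le_rpow_of_exponent_le h1 (le_abs_self s)
    _ ≤ Y ^ |s| := Real.rpow_le_rpow (by linarith) h2 (abs_nonneg s)

theorem one_add_norm_rpow_le_of_mem_ball {V : Type*} [SeminormedAddCommGroup V] (s : ℝ) {y₀ y : V}
    (h : y ∈ Metric.ball y₀ 1) : (1 + ‖y‖) ^ s ≤ (2 + ‖y₀‖) ^ |s| := by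
  refine rpow_le_rpow_abs (by linarith [norm_nonneg y]) ?_
  rw [mem_ball_iff_norm] at h
  have := norm_sub_norm_le y y₀
  linarith

theorem IsSymbolS11.contDiff_right {d : ℕ} {m : ℝ} {a : RD d → RD d → ℂ}
    (ha : IsSymbolS11 d m a) (x : RD d) : ContDiff ℝ ∞ (a x) :=
  ha.1.comp (contDiff_const.prodMk contDiff_id)

theorem IsSymbolS11.exists_bound {d : ℕ} {m : ℝ} {a : RD d → RD d → ℂ}
    (ha : IsSymbolS11 d m a) : ∃ c : ℕ → ℝ, ∀ n x ξ,
      ‖iteratedFDeriv ℝ n (a x) ξ‖ ≤ c n * (1 + ‖ξ‖) ^ (m - n) := by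
  choose c hc using fun n => ha.2 n 0
  refine ⟨c, fun n x ξ => ?_⟩
  have h := hc n x ξ
  have h2 : (fun ξ' => iteratedFDeriv ℝ 0 (fun x' => a x' ξ') x) =
      (continuousMultilinearCurryFin0 ℝ (RD d) ℂ).symm ∘ a x := by
    ext1 ξ'
    rw [iteratedFDeriv_zero_eq_comp]
    rfl
  rw [h2, LinearIsometryEquiv.norm_iteratedFDeriv_comp_left] at h
  simpa using h

/-- Increments of a symbol in `x` form a symbol of order one higher. -/
theorem IsSymbolS11.exists_bound_sub {d : ℕ} {m : ℝ} {a : RD d → RD d → ℂ}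
    (ha : IsSymbolS11 d m a) : ∃ c : ℕ → ℝ, ∀ n x x' ξ,
      ‖iteratedFDeriv ℝ n (fun ξ => a x ξ - a x' ξ) ξ‖ ≤
        c n * ‖x - x'‖ * (1 + ‖ξ‖) ^ (m + 1 - n) := by
  choose c hc using fun n => ha.2 n 1
  refine ⟨fun n => |c n|, fun n x x' ξ => ?_⟩
  set h := x - x' with hh
  set F : ℝ → RD d → ℂ := fun t ξ => iteratedFDeriv ℝ 1 (fun y => a y ξ) (x' + t • h) (fun _ => h)
    with hF
  set A : (RD d [×1]→L[ℝ] ℂ) →L[ℝ] ℂ :=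
    ContinuousMultilinearMap.apply ℝ (fun _ : Fin 1 => RD d) ℂ (fun _ => h)
  have hswap : ContDiff ℝ ∞ fun p : RD d × RD d => a p.2 p.1 :=
    ha.1.comp (contDiff_snd.prodMk contDiff_fst)
  have hJ := contDiff_iteratedFDeriv_param (f := fun ξ y => a y ξ) hswap 1
  have hFsm : ContDiff ℝ ∞ fun p : ℝ × RD d => F p.1 p.2 := by
    refine A.contDiff.comp (hJ.comp (contDiff_snd.prodMk ?_))
    exact contDiff_const.add (contDiff_fst.smul contDiff_const)
  have hFt : ∀ t, ContDiff ℝ ∞ (F t) := fun t => hFsm.comp (contDiff_const.prodMk contDiff_id)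
  have hA : ‖A‖ ≤ ‖h‖ := by
    refine ContinuousLinearMap.opNorm_le_bound _ (norm_nonneg _) fun J => ?_
    have := J.le_opNorm (fun _ => h)
    simpa [mul_comm, A] using this
  have hbd : ∀ n t ξ, ‖iteratedFDeriv ℝ n (F t) ξ‖ ≤
      |c n| * ‖h‖ * (1 + ‖ξ‖) ^ (m + 1 - n) := by
    intro n t ξ
    have hc' := hc n (x' + t • h) ξ
    have hJt : ContDiff ℝ ∞ fun ξ => iteratedFDeriv ℝ 1 (fun y => a y ξ) (x' + t • h) :=
      hJ.comp (contDiff_id.prodMk contDiff_const)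
    have h1 : iteratedFDeriv ℝ n (F t) ξ = A.compContinuousMultilinearMap
        (iteratedFDeriv ℝ n (fun ξ => iteratedFDeriv ℝ 1 (fun y => a y ξ) (x' + t • h)) ξ) :=
      A.iteratedFDeriv_comp_left hJt.contDiffAt (by exact_mod_cast le_top)
    rw [h1]
    refine (A.norm_compContinuousMultilinearMap_le _).trans ?_
    calc _ ≤ ‖h‖ * (|c n| * (1 + ‖ξ‖) ^ (m - n + (1:ℕ))) := by
          refine mul_le_mul hA (hc'.trans ?_) (norm_nonneg _) (norm_nonneg _)
          gcongr
          exact le_abs_self _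
      _ = _ := by
          rw [show m - n + ((1:ℕ):ℝ) = m + 1 - n by push_cast; ring]
          ring
  have hInt : ∀ ξ, a x ξ - a x' ξ = ∫ t in Set.Ioc (0:ℝ) 1, F t ξ := by
    intro ξ
    rw [← intervalIntegral.integral_of_le zero_le_one]
    have hder : ∀ t ∈ Set.uIcc (0:ℝ) 1, HasDerivAt (fun t : ℝ => a (x' + t • h) ξ) (F t ξ) t := by
      intro t _
      have h1 : HasFDerivAt (fun y => a y ξ) (fderiv ℝ (fun y => a y ξ) (x' + t • h))
          (x' + t • h) :=
        (((ha.1.comp (contDiff_id.prodMk contDiff_const)).differentiable (by simp)) _).hasFDerivAt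
      have h2 : HasDerivAt (fun t : ℝ => x' + t • h) h t := by
        simpa using ((hasDerivAt_id t).smul_const h).const_add x'
      have := h1.comp_hasDerivAt t h2
      rw [hF]
      simp only [iteratedFDeriv_one_apply]
      exact this
    rw [intervalIntegral.integral_eq_sub_of_hasDerivAt hder]
    · simp [hh]
    · refine Continuous.intervalIntegrable ?_ _ _
      exact hFsm.continuous.comp (continuous_id.prodMk continuous_const)
  have hmain := (contDiff_integral_of_dominated (ρ := volume.restrict (Set.Ioc (0:ℝ) 1)) hFt
    (fun n y => ?_) (fun n y₀ => ?_)).2 n ξ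
  · rw [funext hInt, hmain]
    refine (norm_integral_le_of_norm_le_const (C := |c n| * ‖h‖ * (1 + ‖ξ‖) ^ (m + 1 - n))
      (Eventually.of_forall fun t => hbd n t ξ)).trans ?_
    simp
  · exact ((contDiff_iteratedFDeriv_param hFsm n).continuous.comp
      (continuous_id.prodMk continuous_const)).aestronglyMeasurable
  · refine ⟨fun _ => |c n| * ‖h‖ * (2 + ‖y₀‖) ^ |m + 1 - n|, integrable_const _, fun t y hy => ?_⟩
    refine (hbd n t y).trans ?_
    exact mul_le_mul_of_nonneg_left (one_add_norm_rpow_le_of_mem_ball _ hy) (by positivity)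

theorem continuous_cutBump_dilate (d k : ℕ) :
    Continuous fun ξ : RD d => cutBump d k (((2:ℝ)^k)⁻¹ • ξ) :=
  (contDiff_cutBump d k).continuous.comp (continuous_const_smul _)

theorem hasCompactSupport_cutBump_dilate (d k : ℕ) :
    HasCompactSupport fun ξ : RD d => cutBump d k (((2:ℝ)^k)⁻¹ • ξ) :=
  (hasCompactSupport_cutBump d k).comp_smul (by positivity)

theorem continuous_fourierChar_inner {d : ℕ} :
    Continuous fun p : RD d × RD d => (Real.fourierChar ⟪p.1, p.2⟫ : ℂ) :=
  continuous_subtype_val.comp (Real.continuous_fourierChar.comp continuous_inner)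

theorem integrable_cutKernel_integrand {d : ℕ} (k : ℕ) {b : RD d → ℂ} (hb : Continuous b)
    (w : RD d) : Integrable fun ξ => b ξ * cutBump d k (((2:ℝ)^k)⁻¹ • ξ) *
      (Real.fourierChar ⟪w, ξ⟫ : ℂ) := by
  refine Continuous.integrable_of_hasCompactSupport ?_ ?_
  · exact (hb.mul (continuous_cutBump_dilate d k)).mul
      (continuous_fourierChar_inner.comp (continuous_const.prodMk continuous_id))
  · exact ((hasCompactSupport_cutBump_dilate d k).mul_left).mul_right

theorem cutKernel_sub {d : ℕ} (k : ℕ) {b b' : RD d → ℂ} (hb : Continuous b) (hb' : Continuous b')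
    (w : RD d) : cutKernel k b w - cutKernel k b' w = cutKernel k (fun ξ => b ξ - b' ξ) w := by
  unfold cutKernel
  rw [← integral_sub (integrable_cutKernel_integrand k hb w)
    (integrable_cutKernel_integrand k hb' w)]
  congr 1
  ext ξ
  ring

/-- Kernel estimates for the frequency-localised pieces of a symbol in `S^m_{1,1}`. -/
theorem IsSymbolS11.exists_cutKernel_bounds {d : ℕ} {m : ℝ} {a : RD d → RD d → ℂ}
    (ha : IsSymbolS11 d m a) (L : ℕ) : ∃ C : ℝ, 0 ≤ C ∧
      (∀ k x w, ‖cutKernel k (a x) w‖ ≤ C * ((2:ℝ)^k) ^ m * decayWeight L k w) ∧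
      (∀ k x x' w, ‖cutKernel k (a x) w - cutKernel k (a x') w‖ ≤
        C * ((2:ℝ)^k) ^ m * (2 ^ k * ‖x - x'‖) * decayWeight L k w) ∧
      ∀ k x x' z ρ, 2 ^ k * ‖x - x'‖ ≤ ρ →
        ‖cutKernel k (a x) (x - z) - cutKernel k (a x') (x' - z)‖ ≤
          C * (1 + ρ) ^ L * ((2:ℝ)^k) ^ m * (2 ^ k * ‖x - x'‖) * decayWeight L k (x - z) := by
  obtain ⟨c, hc⟩ := ha.exists_bound
  obtain ⟨c', hc'⟩ := ha.exists_bound_sub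
  obtain ⟨C₁, hC₁, h₁⟩ := exists_norm_cutKernel_le d L m c
  obtain ⟨C₂, hC₂, h₂⟩ := exists_norm_cutKernel_le d L (m + 1) c'
  have hA : ∀ k x, _ := fun k x => h₁ k (a x) 1 zero_le_one (ha.contDiff_right x)
    (fun n ξ => by rw [mul_one]; exact hc n x ξ)
  have hB : ∀ k x x' w, ‖cutKernel k (a x) w - cutKernel k (a x') w‖ ≤
        C₂ * ((2:ℝ)^k) ^ m * (2 ^ k * ‖x - x'‖) * decayWeight L k w := by
    intro k x x' w
    rw [cutKernel_sub k (ha.contDiff_right x).continuous (ha.contDiff_right x').continuous]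
    refine ((h₂ k _ ‖x - x'‖ (norm_nonneg _) ((ha.contDiff_right x).sub (ha.contDiff_right x'))
      (fun n ξ => hc' n x x' ξ)).1 w).trans (le_of_eq ?_)
    rw [Real.rpow_add_one (by positivity)]
    ring
  refine ⟨C₁ + C₂, by positivity, fun k x w => ?_, fun k x x' w => ?_, fun k x x' z ρ hρ => ?_⟩
  · have := (hA k x).1 w
    rw [mul_one] at this
    refine this.trans ?_
    have := decayWeight_nonneg L k w
    gcongr
    linarith
  · refine (hB k x x' w).trans ?_
    have := decayWeight_nonneg L k w
    gcongr
    linarith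
  · have hρ0 : 0 ≤ ρ := le_trans (by positivity) hρ
    have e : (x - z) - (x' - z) = x - x' := by abel
    have h3 := hB k x x' (x - z)
    have h4 := (hA k x').2 (x - z) (x' - z) ρ (by rwa [e])
    rw [e, mul_one] at h4
    have hw := decayWeight_nonneg L k (x - z)
    have h5 : C₂ * ((2:ℝ)^k) ^ m * (2 ^ k * ‖x - x'‖) * decayWeight L k (x - z) ≤
        C₂ * (1 + ρ) ^ L * ((2:ℝ)^k) ^ m * (2 ^ k * ‖x - x'‖) * decayWeight L k (x - z) := by
      have : 1 ≤ (1 + ρ) ^ L := one_le_pow₀ (by linarith)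
      gcongr
      nlinarith
    calc _ = ‖(cutKernel k (a x) (x - z) - cutKernel k (a x') (x - z)) +
          (cutKernel k (a x') (x - z) - cutKernel k (a x') (x' - z))‖ := by congr 1; ring
      _ ≤ _ := norm_add_le _ _
      _ ≤ _ := add_le_add (h3.trans h5) h4
      _ = _ := by ring

theorem exp_eq_fourierChar (t : ℝ) :
    Complex.exp (2 * Real.pi * Complex.I * (t : ℂ)) = (Real.fourierChar t : ℂ) := by
  rw [Real.fourierChar_apply]
  congr 1
  push_cast
  ring

theorem contDiff_fourierChar_inner {d : ℕ} (x : RD d) :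
    ContDiff ℝ ∞ fun ξ : RD d => (Real.fourierChar ⟪x, ξ⟫ : ℂ) := by
  simp_rw [← exp_eq_fourierChar]
  refine ContDiff.cexp (contDiff_const.mul ?_)
  exact Complex.ofRealCLM.contDiff.comp (contDiff_const.inner ℝ contDiff_id)

theorem fourierS_translate {d : ℕ} (f : 𝓢(RD d, ℂ)) (y ξ : RD d) :
    fourierS (compSubConstCLM ℂ y f) ξ = (Real.fourierChar (-⟪ξ, y⟫) : ℂ) * fourierS f ξ := by
  rw [fourierS_apply, fourierS_apply, ← integral_const_mul,
    ← integral_add_right_eq_self _ y]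
  refine integral_congr_ae (Eventually.of_forall fun v => ?_)
  simp only [compSubConstCLM_apply, add_sub_cancel_right, inner_add_left, Circle.smul_def,
    smul_eq_mul, neg_add, AddChar.map_add_eq_mul, Circle.coe_mul, real_inner_comm ξ y]
  ring

/-- The symbol convolved in `x` with a Schwartz function is smooth in `ξ`. -/
theorem IsSymbolS11.contDiff_integral_mul {d : ℕ} {m : ℝ} {a : RD d → RD d → ℂ}
    (ha : IsSymbolS11 d m a) (f : 𝓢(RD d, ℂ)) (x : RD d) :
    ContDiff ℝ ∞ fun ξ => ∫ y, f y * a (x - y) ξ := by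
  obtain ⟨c, hc⟩ := ha.exists_bound
  have hF : ∀ (n : ℕ) (y ξ : RD d), iteratedFDeriv ℝ n (fun ξ => f y * a (x - y) ξ) ξ =
      f y • iteratedFDeriv ℝ n (a (x - y)) ξ := fun n y ξ =>
    iteratedFDeriv_const_smul_apply' (a := f y)
      ((ha.contDiff_right (x - y)).of_le (by exact_mod_cast le_top)).contDiffAt
  refine (contDiff_integral_of_dominated (ρ := volume)
    (fun y => contDiff_const.mul (ha.contDiff_right (x - y))) (fun n ξ => ?_) (fun n ξ₀ => ?_)).1
  · simp only [hF]
    exact (f.continuous.smul ((contDiff_iteratedFDeriv_param ha.1 n).continuous.comp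
      ((continuous_const.sub continuous_id).prodMk continuous_const))).aestronglyMeasurable
  · refine ⟨fun y => ‖f y‖ * (|c n| * (2 + ‖ξ₀‖) ^ |m - n|), f.integrable.norm.mul_const _,
      fun y ξ hξ => ?_⟩
    rw [hF, norm_smul]
    refine mul_le_mul_of_nonneg_left ((hc n _ _).trans ?_) (norm_nonneg _)
    exact mul_le_mul (le_abs_self _) (one_add_norm_rpow_le_of_mem_ball _ hξ) (by positivity)
      (abs_nonneg _)

theorem contDiff_cutBump_dilate (d k : ℕ) :
    ContDiff ℝ ∞ fun ξ : RD d => cutBump d k (((2:ℝ)^k)⁻¹ • ξ) :=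
  (contDiff_cutBump d k).comp (contDiff_const_smul _)

theorem IsSymbolS11.integral_integral_mul_swap {d : ℕ} {m : ℝ} {a : RD d → RD d → ℂ}
    (ha : IsSymbolS11 d m a) (f : 𝓢(RD d, ℂ)) (x : RD d) {χ : RD d → ℂ} (hχ : Continuous χ)
    (hχc : HasCompactSupport χ) :
    ∫ ξ, (∫ y, f y * a (x - y) ξ) * χ ξ = ∫ y, f y * ∫ ξ, a (x - y) ξ * χ ξ := by
  obtain ⟨c, hc⟩ := ha.exists_bound
  have h1 : ∀ ξ, (∫ y, f y * a (x - y) ξ) * χ ξ = ∫ y, f y * (a (x - y) ξ * χ ξ) := by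
    intro ξ
    rw [← integral_mul_const]
    congr 1
    ext y
    ring
  simp_rw [h1, ← integral_const_mul]
  have hg : Integrable fun ξ : RD d => c 0 * (1 + ‖ξ‖) ^ (m - (0:ℕ)) * ‖χ ξ‖ := by
    refine Continuous.integrable_of_hasCompactSupport ?_ ?_
    · refine (continuous_const.mul ((continuous_const.add continuous_norm).rpow_const
        fun ξ => Or.inl ?_)).mul hχ.norm
      exact ne_of_gt (show (0:ℝ) < 1 + ‖ξ‖ by positivity)
    · exact hχc.norm.mul_left
  have hInt : Integrable (Function.uncurry fun ξ y : RD d => f y * (a (x - y) ξ * χ ξ))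
      (volume.prod volume) := by
    refine (hg.mul_prod f.integrable.norm).mono' ?_ (Eventually.of_forall fun p => ?_)
    · have h2 : Continuous fun p : RD d × RD d => a (x - p.2) p.1 :=
        ha.1.continuous.comp ((continuous_const.sub continuous_snd).prodMk continuous_fst)
      exact ((f.continuous.comp continuous_snd).mul
        (h2.mul (hχ.comp continuous_fst))).aestronglyMeasurable
    · have := hc 0 (x - p.2) p.1
      rw [norm_iteratedFDeriv_zero] at this
      simp only [Function.uncurry, norm_mul]
      rw [mul_comm]
      gcongr
  exact integral_integral_swap hInt

theorem integral_fourierChar_cut_swap {d : ℕ} {m : ℝ} {a : RD d → RD d → ℂ}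
    (ha : IsSymbolS11 d m a) (f : 𝓢(RD d, ℂ)) (k : ℕ) (x w : RD d) :
    ∫ ξ, (∫ y, f y * a (x - y) ξ) * cutBump d k (((2:ℝ)^k)⁻¹ • ξ) * (Real.fourierChar ⟪w, ξ⟫ : ℂ) =
      ∫ y, f y * cutKernel k (a (x - y)) w := by
  have h := ha.integral_integral_mul_swap f x (χ := fun ξ => cutBump d k (((2:ℝ)^k)⁻¹ • ξ) *
      (Real.fourierChar ⟪w, ξ⟫ : ℂ))
    ((continuous_cutBump_dilate d k).mul (contDiff_fourierChar_inner w).continuous)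
    (hasCompactSupport_cutBump_dilate d k).mul_right
  simp only [← mul_assoc] at h
  exact h

/-- Each piece of the operator is an integral operator acting on `Π_k u`. -/
theorem pdoPieceD_eq_integral {d : ℕ} (D : LPData d) {m : ℝ} {a : RD d → RD d → ℂ}
    (ha : IsSymbolS11 d m a) (j k : ℕ) (u : TD d) (x : RD d) :
    pdoPieceD D a j k u x =
      ∫ z, (∫ y, LPkernelS D j y * cutKernel k (a (x - y)) (x - z)) * LPdist D k u z := by
  set A : RD d → ℂ := fun ξ => ∫ y, LPkernelS D j y * a (x - y) ξ with hA
  have hAs : ContDiff ℝ ∞ A := ha.contDiff_integral_mul _ x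
  set B : RD d → ℂ := fun ξ => A ξ * cutBump d k (((2:ℝ)^k)⁻¹ • ξ) * (Real.fourierChar ⟪x, ξ⟫ : ℂ)
    with hB
  have hBs : ContDiff ℝ ∞ B :=
    (hAs.mul (contDiff_cutBump_dilate d k)).mul (contDiff_fourierChar_inner x)
  have hBc : HasCompactSupport B := ((hasCompactSupport_cutBump_dilate d k).mul_left).mul_right
  have hGs : ContDiff ℝ ∞ fun ξ => B ξ * fourierS (LPkernelS D k) ξ :=
    hBs.mul ((fourierS (LPkernelS D k)).smooth ⊤)
  have hGc : HasCompactSupport fun ξ => B ξ * fourierS (LPkernelS D k) ξ := hBc.mul_right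
  set BS : 𝓢(RD d, ℂ) := hBc.toSchwartzMap hBs with hBS
  set GS : 𝓢(RD d, ℂ) := hGc.toSchwartzMap hGs with hGS
  obtain ⟨ψ, hψ⟩ := exists_reflection (LPkernelS D k)
  have hpair : pdoPieceD D a j k u x = u (fourierS GS) := by
    refine (pairing_eq (fourierTD u) GS _ fun ξ => ?_).trans rfl
    change B ξ * fourierS (LPkernelS D k) ξ = _
    rw [exp_eq_fourierChar, fourierS_LPkernelS, symbolPiece]
    simp only [hB, hA, LPkernelS_apply]
    have e := cutBump_mul_LPhat D k ξ
    generalize (Real.fourierChar ⟪x, ξ⟫ : ℂ) = v at *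
    linear_combination ((∫ y, LPkernel D j y * a (x - y) ξ) * v) * e
  have hconv : ∀ y, fourierS GS y = ∫ z, fourierS BS z * ψ (y - z) := by
    intro y
    have h := SchwartzMap.integral_fourier_mul_eq (compSubConstCLM ℂ y (LPkernelS D k)) BS
    have h1 : ∀ ξ, FourierTransform.fourier (compSubConstCLM ℂ y (LPkernelS D k)) ξ =
        (Real.fourierChar (-⟪ξ, y⟫) : ℂ) * fourierS (LPkernelS D k) ξ := fun ξ =>
      fourierS_translate _ _ _
    simp_rw [h1] at h
    rw [fourierS_apply]
    refine Eq.trans ?_ (h.trans ?_)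
    · refine integral_congr_ae (Eventually.of_forall fun ξ => ?_)
      change _ • (B ξ * fourierS (LPkernelS D k) ξ) = _ * B ξ
      rw [Circle.smul_def, smul_eq_mul]
      ring
    · refine integral_congr_ae (Eventually.of_forall fun z => ?_)
      simp only [compSubConstCLM_apply, hψ, neg_sub]
      rw [mul_comm]
      rfl
  rw [hpair, apply_eq_integral_translate u (fourierS BS) ψ (fourierS GS) hconv]
  refine integral_congr_ae (Eventually.of_forall fun z => ?_)
  simp only
  rw [LPdist_eq D k u ψ hψ z, ← integral_fourierChar_cut_swap ha, fourierS_apply]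
  congr 1
  refine integral_congr_ae (Eventually.of_forall fun ξ => ?_)
  have e1 : (Real.fourierChar ⟪x - z, ξ⟫ : ℂ) =
      (Real.fourierChar ⟪x, ξ⟫ : ℂ) * (Real.fourierChar (-⟪ξ, z⟫) : ℂ) := by
    rw [inner_sub_left, sub_eq_add_neg, AddChar.map_add_eq_mul, Circle.coe_mul,
      real_inner_comm z ξ]
  change Real.fourierChar (-⟪ξ, z⟫) • B ξ = A ξ * cutBump d k (((2:ℝ)^k)⁻¹ • ξ) *
    (Real.fourierChar ⟪x - z, ξ⟫ : ℂ)
  rw [Circle.smul_def, smul_eq_mul, e1]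
  simp only [hB]
  ring

theorem measurableSet_cube (d : ℕ) (c : RD d) (ℓ : ℝ) : MeasurableSet (cube d c ℓ) := by
  have : cube d c ℓ = ⋂ i, {x : RD d | c i ≤ x i ∧ x i ≤ c i + ℓ} := by
    ext x
    simp [cube]
  rw [this]
  refine MeasurableSet.iInter fun i => ?_
  have hm : Continuous fun x : RD d => x i := by fun_prop
  exact ((isClosed_le continuous_const hm).inter (isClosed_le hm continuous_const)).measurableSet

theorem volume_cube (d : ℕ) (c : RD d) {ℓ : ℝ} (hℓ : 0 ≤ ℓ) :
    volume (cube d c ℓ) = ENNReal.ofReal (ℓ ^ d) := by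
  have h1 : cube d c ℓ = (@WithLp.ofLp 2 (Fin d → ℝ)) ⁻¹'
      (Set.Icc (WithLp.ofLp c) (fun i => c i + ℓ)) := by
    ext x
    simp only [cube, Set.mem_ofPred_eq, Set.mem_preimage, Set.mem_Icc, Pi.le_def]
    exact forall_and
  rw [h1, (PiLp.volume_preserving_ofLp (Fin d)).measure_preimage
    measurableSet_Icc.nullMeasurableSet, Real.volume_Icc_pi]
  simp [ENNReal.ofReal_pow hℓ]

theorem norm_sub_le_of_mem_cube {d : ℕ} {c x y : RD d} {ℓ : ℝ} (hℓ : 0 ≤ ℓ)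
    (hx : x ∈ cube d c ℓ) (hy : y ∈ cube d c ℓ) : ‖x - y‖ ≤ d * ℓ := by
  rw [EuclideanSpace.norm_eq]
  refine Real.sqrt_le_iff.2 ⟨by positivity, ?_⟩
  have : ∀ i ∈ (Finset.univ : Finset (Fin d)), ‖(x - y) i‖ ^ 2 ≤ ℓ ^ 2 := fun i _ => by
    have h1 := hx i
    have h2 := hy i
    rw [Real.norm_eq_abs, sq_abs]
    refine sq_le_sq' ?_ ?_ <;> simp only [PiLp.sub_apply] <;> linarith
  refine (Finset.sum_le_sum this).trans ?_
  rw [Finset.sum_const, Finset.card_univ, Fintype.card_fin, nsmul_eq_mul, mul_pow]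
  have h3 : (d:ℝ) ≤ (d:ℝ) ^ 2 := by
    exact_mod_cast Nat.le_self_pow two_ne_zero d
  exact mul_le_mul_of_nonneg_right h3 (by positivity)

/-- A bound on dyadic cubes of side `2^{-μ}` yields a bound on arbitrary cubes. -/
theorem lintegral_cube_le_of_dyadicCube (d μ : ℕ) (F : RD d → ℝ≥0∞) (A : ℝ≥0∞)
    (h : ∀ n, ∫⁻ x in dyadicCube d μ n, F x ≤ A) (c : RD d) {R : ℝ} (hR : 0 ≤ R) :
    ∫⁻ x in cube d c (R * ((2:ℝ)^μ)⁻¹), F x ≤ ENNReal.ofReal ((R + 2) ^ d) * A := by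
  set s : Finset (Fin d → ℤ) := Fintype.piFinset fun i =>
    Finset.Icc ⌊c i * 2 ^ μ⌋ ⌊c i * 2 ^ μ + R⌋ with hs
  have hp : (0:ℝ) < 2 ^ μ := by positivity
  have hsub : cube d c (R * ((2:ℝ)^μ)⁻¹) ⊆ ⋃ n : s, dyadicCube d μ n := by
    intro x hx
    refine Set.mem_iUnion.2 ⟨⟨fun i => ⌊x i * 2 ^ μ⌋, ?_⟩, fun i => ?_⟩
    · refine Fintype.mem_piFinset.2 fun i => Finset.mem_Icc.2 ⟨?_, ?_⟩
      · exact Int.floor_le_floor (mul_le_mul_of_nonneg_right (hx i).1 hp.le)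
      · refine Int.floor_le_floor ((mul_le_mul_of_nonneg_right (hx i).2 hp.le).trans (le_of_eq ?_))
        field_simp
    · have e : (2:ℝ) ^ (-(μ:ℤ)) = (2 ^ μ)⁻¹ := by rw [zpow_neg, zpow_natCast]
      change (⌊x i * 2 ^ μ⌋ : ℝ) * (2:ℝ) ^ (-(μ:ℤ)) ≤ x i ∧
        x i < ((⌊x i * 2 ^ μ⌋ : ℝ) + 1) * (2:ℝ) ^ (-(μ:ℤ))
      rw [e, ← div_eq_mul_inv, ← div_eq_mul_inv, div_le_iff₀ hp, lt_div_iff₀ hp]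
      exact ⟨Int.floor_le _, Int.lt_floor_add_one _⟩
  have hcard : (s.card : ℝ) ≤ (R + 2) ^ d := by
    rw [hs, Fintype.card_piFinset]
    push_cast
    refine (Finset.prod_le_prod (fun i _ => by positivity) (fun i _ => ?_)).trans
      (le_of_eq (by rw [Finset.prod_const, Finset.card_univ, Fintype.card_fin]))
    rw [Int.card_Icc]
    have h1 := Int.floor_le (c i * 2 ^ μ + R)
    have h2 := Int.lt_floor_add_one (c i * 2 ^ μ)
    have h3 : ⌊c i * 2 ^ μ⌋ ≤ ⌊c i * 2 ^ μ + R⌋ := Int.floor_le_floor (by linarith)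
    have h4 : ((⌊c i * 2 ^ μ + R⌋ + 1 - ⌊c i * 2 ^ μ⌋).toNat : ℝ) =
        ((⌊c i * 2 ^ μ + R⌋ + 1 - ⌊c i * 2 ^ μ⌋ : ℤ) : ℝ) := by
      exact_mod_cast Int.toNat_of_nonneg (by linarith)
    rw [h4]
    push_cast
    linarith
  calc ∫⁻ x in cube d c (R * ((2:ℝ)^μ)⁻¹), F x
      ≤ ∫⁻ x in ⋃ n : s, dyadicCube d μ n, F x := lintegral_mono_set hsub
    _ ≤ ∑' n : s, ∫⁻ x in dyadicCube d μ n, F x := lintegral_iUnion_le _ _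
    _ ≤ ∑' _ : s, A := ENNReal.tsum_le_tsum fun n => h n
    _ = s.card * A := by simp [tsum_fintype]
    _ ≤ _ := by
      gcongr
      rw [← ENNReal.ofReal_natCast]
      exact ENNReal.ofReal_le_ofReal hcard

/-- Convolution of a nonnegative function with the decaying weight at frequency scale `2^k`. -/
def smoothed {d : ℕ} (L k : ℕ) (h : RD d → ℝ≥0∞) (x : RD d) : ℝ≥0∞ :=
  ∫⁻ z, ENNReal.ofReal (decayWeight L k (x - z)) * h z

/-- The weighted mass of the decay profile. -/
def decayMass (d L : ℕ) : ℝ≥0∞ :=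
  ∫⁻ v : RD d, ENNReal.ofReal (((1 + ‖v‖) ^ L)⁻¹) * ENNReal.ofReal ((1 + ‖v‖) ^ d)

/-- The sequence `h` satisfies the local Carleson-type bound defining the `F_∞` norms. -/
structure IsCarleson {d : ℕ} (h : ℕ → RD d → ℝ≥0∞) (H : ℝ≥0∞) : Prop where
  ne_top : H ≠ ⊤
  measurable : ∀ k, Measurable (h k)
  zero_le : ∀ x, h 0 x ≤ H
  dyadic_le : ∀ μ : ℕ, 1 ≤ μ → ∀ n, ∫⁻ x in dyadicCube d μ n, ∑' j, h (μ + j) x ≤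
    ENNReal.ofReal ((((2:ℝ) ^ μ)⁻¹) ^ d) * H

theorem continuous_decayWeight {d : ℕ} (L k : ℕ) :
    Continuous (decayWeight L k : RD d → ℝ) := by
  unfold decayWeight
  refine continuous_const.mul (Continuous.inv₀ (by fun_prop) fun w => ?_)
  positivity

theorem decayMass_ne_top {d L : ℕ} (hL : 2 * d < L) : decayMass d L ≠ ⊤ := by
  have h := (integrable_one_add_norm (E := RD d) (μ := volume) (r := (L:ℝ) - d) (by
    rw [finrank_euclideanSpace_fin]
    have : (2 * d : ℝ) < L := by exact_mod_cast hL
    linarith)).lintegral_lt_top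
  refine ne_of_eq_of_ne (lintegral_congr fun v => ?_) h.ne
  rw [← ENNReal.ofReal_mul (by positivity)]
  congr 1
  rw [neg_sub, Real.rpow_sub (by positivity), Real.rpow_natCast, Real.rpow_natCast]
  ring

theorem smoothed_eq {d : ℕ} (L k : ℕ) (h : RD d → ℝ≥0∞) (x : RD d) :
    smoothed L k h x =
      ∫⁻ v, ENNReal.ofReal (((1 + ‖v‖) ^ L)⁻¹) * h (x - ((2:ℝ)^k)⁻¹ • v) := by
  set g : RD d → ℝ≥0∞ := fun v => ENNReal.ofReal (((1 + ‖v‖) ^ L)⁻¹) * h (x - ((2:ℝ)^k)⁻¹ • v)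
  have hp : (0:ℝ) < 2 ^ k := by positivity
  have hmap := Measure.map_addHaar_smul (volume : Measure (RD d)) hp.ne'
  have h1 : ∫⁻ w, g ((2:ℝ)^k • w) =
      ENNReal.ofReal |(((2:ℝ)^k) ^ Module.finrank ℝ (RD d))⁻¹| * ∫⁻ v, g v := by
    rw [← smul_eq_mul, ← lintegral_smul_measure, ← hmap]
    exact ((Homeomorph.smulOfNeZero _ hp.ne').measurableEmbedding.lintegral_map g).symm
  rw [finrank_euclideanSpace_fin, abs_of_nonneg (by positivity)] at h1
  have h2 : smoothed L k h x = ∫⁻ w, ENNReal.ofReal ((2:ℝ) ^ (k * d)) * g ((2:ℝ)^k • w) := by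
    rw [smoothed, ← lintegral_sub_left_eq_self _ x]
    refine lintegral_congr fun w => ?_
    simp only [g, sub_sub_cancel]
    rw [smul_smul, inv_mul_cancel₀ hp.ne', one_smul, ← mul_assoc, ← ENNReal.ofReal_mul
      (by positivity), norm_smul, Real.norm_of_nonneg hp.le]
    rfl
  rw [h2, lintegral_const_mul' _ _ ENNReal.ofReal_ne_top, h1, ← mul_assoc,
    ← ENNReal.ofReal_mul (by positivity), pow_mul, mul_inv_cancel₀ (by positivity),
    ENNReal.ofReal_one, one_mul]

theorem measurable_smoothed {d : ℕ} (L k : ℕ) {h : RD d → ℝ≥0∞} (hh : Measurable h) :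
    Measurable (smoothed L k h) := by
  refine Measurable.lintegral_prod_right' (f := fun p : RD d × RD d =>
    ENNReal.ofReal (decayWeight L k (p.1 - p.2)) * h p.2) ?_
  exact (((continuous_decayWeight L k).comp
    (continuous_fst.sub continuous_snd)).measurable.ennreal_ofReal).mul (hh.comp measurable_snd)

theorem decayWeight_le {d : ℕ} (L k : ℕ) {w w' : RD d} {ρ : ℝ} (hρ : 2 ^ k * ‖w - w'‖ ≤ ρ) :
    decayWeight L k w ≤ (1 + ρ) ^ L * decayWeight L k w' := by
  have hρ0 : 0 ≤ ρ := le_trans (by positivity) hρ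
  have h1 : 1 + 2 ^ k * ‖w'‖ ≤ (1 + ρ) * (1 + 2 ^ k * ‖w‖) := by
    have : ‖w'‖ ≤ ‖w‖ + ‖w - w'‖ := by
      rw [norm_sub_rev]
      exact norm_le_norm_add_norm_sub' _ _
    have h2 : (2:ℝ) ^ k * ‖w'‖ ≤ 2 ^ k * (‖w‖ + ‖w - w'‖) := by gcongr
    have h3 : 0 ≤ ρ * (2 ^ k * ‖w‖) := by positivity
    nlinarith
  have h2 := pow_le_pow_left₀ (by positivity) h1 L
  rw [mul_pow] at h2
  unfold decayWeight
  rw [mul_left_comm]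
  refine mul_le_mul_of_nonneg_left ?_ (by positivity)
  rw [inv_le_comm₀ (by positivity) (by positivity), mul_inv, inv_inv, inv_mul_le_iff₀ (by positivity)]
  exact h2

theorem smoothed_le {d : ℕ} (L k : ℕ) (h : RD d → ℝ≥0∞) {x x' : RD d} {ρ : ℝ}
    (hρ : 2 ^ k * ‖x - x'‖ ≤ ρ) :
    smoothed L k h x ≤ ENNReal.ofReal ((1 + ρ) ^ L) * smoothed L k h x' := by
  have hρ0 : 0 ≤ ρ := le_trans (by positivity) hρ
  rw [smoothed, smoothed, ← lintegral_const_mul' _ _ ENNReal.ofReal_ne_top]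
  refine lintegral_mono fun z => ?_
  rw [← mul_assoc, ← ENNReal.ofReal_mul (by positivity)]
  gcongr
  exact decayWeight_le L k (by simpa using hρ)

theorem cube_sub_subset {d : ℕ} {c x w : RD d} {ℓ ρ : ℝ} (hx : x ∈ cube d c ℓ) (hw : ‖w‖ ≤ ρ) :
    x - w ∈ cube d (c - WithLp.toLp 2 fun _ => ρ) (ℓ + 2 * ρ) := by
  intro i
  have h1 : |w i| ≤ ρ := (PiLp.norm_apply_le w i).trans hw
  have h2 := abs_le.1 h1
  have h3 := hx i
  simp only [PiLp.sub_apply]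
  constructor <;> linarith

theorem IsCarleson.lintegral_cube_smoothed {d : ℕ} {h : ℕ → RD d → ℝ≥0∞} {H : ℝ≥0∞}
    (hC : IsCarleson h H) (L : ℕ) {μ : ℕ} (hμ : 1 ≤ μ) (c : RD d) {R : ℝ} (hR : 1 ≤ R) :
    ∫⁻ x in cube d c (R * ((2:ℝ)^μ)⁻¹), ∑' j, smoothed L (μ + j) (h (μ + j)) x ≤
      ENNReal.ofReal ((3 * (R * ((2:ℝ)^μ)⁻¹)) ^ d) * (decayMass d L * H) := by
  set Q := cube d c (R * ((2:ℝ)^μ)⁻¹)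
  have hω : Measurable fun v : RD d => ENNReal.ofReal (((1 + ‖v‖) ^ L)⁻¹) := by
    refine Measurable.ennreal_ofReal ?_
    fun_prop
  have hh : ∀ k, Measurable fun p : RD d × RD d => h k (p.1 - ((2:ℝ)^k)⁻¹ • p.2) := fun k =>
    (hC.measurable k).comp (by fun_prop)
  have h1 : ∫⁻ x in Q, ∑' j, smoothed L (μ + j) (h (μ + j)) x =
      ∫⁻ v, ENNReal.ofReal (((1 + ‖v‖) ^ L)⁻¹) *
        ∫⁻ x in Q, ∑' j, h (μ + j) (x - ((2:ℝ)^(μ + j))⁻¹ • v) := by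
    simp_rw [smoothed_eq]
    have e : ∀ x : RD d, ∑' j, ∫⁻ v, ENNReal.ofReal (((1 + ‖v‖) ^ L)⁻¹) *
        h (μ + j) (x - ((2:ℝ)^(μ + j))⁻¹ • v) = ∫⁻ v, ENNReal.ofReal (((1 + ‖v‖) ^ L)⁻¹) *
        ∑' j, h (μ + j) (x - ((2:ℝ)^(μ + j))⁻¹ • v) := by
      intro x
      rw [← lintegral_tsum]
      · simp_rw [ENNReal.tsum_mul_left]
      · exact fun j => (hω.mul ((hh (μ + j)).comp (measurable_const.prodMk measurable_id))).aemeasurable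
    simp_rw [e]
    rw [lintegral_lintegral_swap]
    · refine lintegral_congr fun v => ?_
      rw [lintegral_const_mul' _ _ ENNReal.ofReal_ne_top]
    · exact ((hω.comp measurable_snd).mul
        (Measurable.tsum fun j => hh (μ + j))).aemeasurable
  rw [h1]
  have h2 : ∀ v : RD d, ∫⁻ x in Q, ∑' j, h (μ + j) (x - ((2:ℝ)^(μ + j))⁻¹ • v) ≤
      ENNReal.ofReal ((1 + ‖v‖) ^ d) * (ENNReal.ofReal ((3 * (R * ((2:ℝ)^μ)⁻¹)) ^ d) * H) := by
    intro v
    set Q' := cube d (c - WithLp.toLp 2 fun _ => ‖v‖ * ((2:ℝ)^μ)⁻¹)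
      ((R + 2 * ‖v‖) * ((2:ℝ)^μ)⁻¹) with hQ'
    have hm : ∀ j, Measurable fun x : RD d => h (μ + j) (x - ((2:ℝ)^(μ + j))⁻¹ • v) := fun j =>
      (hC.measurable _).comp (by fun_prop)
    calc ∫⁻ x in Q, ∑' j, h (μ + j) (x - ((2:ℝ)^(μ + j))⁻¹ • v)
        = ∑' j, ∫⁻ x in Q, h (μ + j) (x - ((2:ℝ)^(μ + j))⁻¹ • v) :=
          lintegral_tsum fun j => (hm j).aemeasurable
      _ ≤ ∑' j, ∫⁻ x in Q', h (μ + j) x := by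
          refine ENNReal.tsum_le_tsum fun j => ?_
          rw [← lintegral_indicator (measurableSet_cube _ _ _),
            ← lintegral_indicator (measurableSet_cube _ _ _),
            ← lintegral_sub_right_eq_self (Set.indicator Q' _) (((2:ℝ)^(μ + j))⁻¹ • v)]
          refine lintegral_mono fun x => ?_
          by_cases hx : x ∈ Q
          swap
          · rw [Set.indicator_of_notMem hx]
            exact bot_le
          rw [Set.indicator_of_mem hx]
          have hx' : x - ((2:ℝ)^(μ + j))⁻¹ • v ∈ Q' := by
            have hw : ‖((2:ℝ)^(μ + j))⁻¹ • v‖ ≤ ‖v‖ * ((2:ℝ)^μ)⁻¹ := by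
              rw [norm_smul, mul_comm, Real.norm_of_nonneg (by positivity)]
              have : (2:ℝ) ^ μ ≤ 2 ^ (μ + j) := pow_le_pow_right₀ (by norm_num) (by omega)
              gcongr
            have := cube_sub_subset hx hw
            rwa [← mul_assoc, ← add_mul] at this
          rw [Set.indicator_of_mem hx']
      _ = ∫⁻ x in Q', ∑' j, h (μ + j) x :=
          (lintegral_tsum fun j => (hC.measurable _).aemeasurable).symm
      _ ≤ ENNReal.ofReal ((R + 2 * ‖v‖ + 2) ^ d) * (ENNReal.ofReal ((((2:ℝ) ^ μ)⁻¹) ^ d) * H) :=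
          lintegral_cube_le_of_dyadicCube d μ _ _ (hC.dyadic_le μ hμ) _ (by positivity)
      _ ≤ _ := by
          rw [← mul_assoc, ← mul_assoc, ← ENNReal.ofReal_mul (by positivity),
            ← ENNReal.ofReal_mul (by positivity), ← mul_pow, ← mul_pow]
          have hv := norm_nonneg v
          refine mul_le_mul_left (ENNReal.ofReal_le_ofReal
            (pow_le_pow_left₀ (by positivity) ?_ d)) _
          have : R + 2 * ‖v‖ + 2 ≤ (1 + ‖v‖) * (3 * R) := by nlinarith
          calc _ ≤ ((1 + ‖v‖) * (3 * R)) * ((2:ℝ)^μ)⁻¹ := by gcongr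
            _ = _ := by ring
  refine (lintegral_mono fun v => mul_le_mul_right (h2 v) _).trans (le_of_eq ?_)
  simp_rw [← mul_assoc]
  rw [lintegral_mul_const' _ _ hC.ne_top, lintegral_mul_const' _ _ ENNReal.ofReal_ne_top, ← decayMass]
  ring

theorem IsCarleson.smoothed_zero_le {d : ℕ} {h : ℕ → RD d → ℝ≥0∞} {H : ℝ≥0∞}
    (hC : IsCarleson h H) (L : ℕ) (x : RD d) : smoothed L 0 (h 0) x ≤ decayMass d L * H := by
  rw [smoothed_eq, decayMass, ← lintegral_mul_const' _ _ hC.ne_top]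
  refine lintegral_mono fun v => mul_le_mul' ?_ (hC.zero_le _)
  refine le_mul_of_one_le_right' ?_
  rw [ENNReal.one_le_ofReal]
  exact one_le_pow₀ (le_add_of_nonneg_right (norm_nonneg v))

/-- The constant in the uniform bound of the smoothed pieces. -/
def smoothedConst (d L : ℕ) : ℝ≥0∞ :=
  ENNReal.ofReal ((1 + d) ^ L) * (ENNReal.ofReal (3 ^ d) * decayMass d L)

theorem smoothedConst_ne_top {d L : ℕ} (hL : 2 * d < L) : smoothedConst d L ≠ ⊤ :=
  ENNReal.mul_ne_top ENNReal.ofReal_ne_top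
    (ENNReal.mul_ne_top ENNReal.ofReal_ne_top (decayMass_ne_top hL))

theorem IsCarleson.smoothed_le_const {d : ℕ} {h : ℕ → RD d → ℝ≥0∞} {H : ℝ≥0∞}
    (hC : IsCarleson h H) (L k : ℕ) (x : RD d) :
    smoothed L k (h k) x ≤ smoothedConst d L * H := by
  rcases Nat.eq_zero_or_pos k with rfl | hk
  · refine (hC.smoothed_zero_le L x).trans ?_
    unfold smoothedConst
    gcongr
    rw [← mul_assoc]
    refine le_mul_of_one_le_left' ?_
    rw [← ENNReal.ofReal_mul (by positivity), ENNReal.one_le_ofReal]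
    refine one_le_mul_of_one_le_of_one_le (one_le_pow₀ ?_) (one_le_pow₀ (by norm_num))
    simp
  · have hp : (0:ℝ) < 2 ^ k := by positivity
    have hx : x ∈ cube d x (1 * ((2:ℝ)^k)⁻¹) := fun i => ⟨le_rfl, by simp⟩
    have h1 : ∀ y ∈ cube d x (1 * ((2:ℝ)^k)⁻¹), smoothed L k (h k) x ≤
        ENNReal.ofReal ((1 + d) ^ L) * ∑' j, smoothed L (k + j) (h (k + j)) y := by
      intro y hy
      refine (smoothed_le L k (h k) (x' := y) (ρ := d) ?_).trans ?_
      · have := norm_sub_le_of_mem_cube (by positivity) hx hy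
        calc _ ≤ (2:ℝ) ^ k * (d * (1 * ((2:ℝ)^k)⁻¹)) := by gcongr
          _ = d := by field_simp
      · gcongr
        exact ENNReal.le_tsum (f := fun j => smoothed L (k + j) (h (k + j)) y) 0
    have h2 := (setLIntegral_mono' (μ := volume) (measurableSet_cube d x _) h1).trans
      (le_of_eq (lintegral_const_mul' _ _ ENNReal.ofReal_ne_top))
    rw [setLIntegral_const, volume_cube _ _ (by positivity)] at h2
    have h3 := h2.trans (mul_le_mul_right (hC.lintegral_cube_smoothed L hk x le_rfl) _)
    have hv : ENNReal.ofReal ((1 * ((2:ℝ)^k)⁻¹) ^ d) ≠ 0 := by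
      rw [Ne, ENNReal.ofReal_eq_zero, not_le]
      positivity
    rw [← ENNReal.mul_le_mul_iff_left hv ENNReal.ofReal_ne_top]
    refine h3.trans (le_of_eq ?_)
    rw [mul_pow 3, ENNReal.ofReal_mul (by positivity), smoothedConst]
    ring

/-- The weighted modulus `2^{km} |Π_k u|`. -/
def lpWeight {d : ℕ} (D : LPData d) (m : ℝ) (u : TD d) (k : ℕ) (z : RD d) : ℝ≥0∞ :=
  ENNReal.ofReal (((2:ℝ)^k) ^ m) * ‖LPdist D k u z‖ₑ

theorem measurable_lpWeight {d : ℕ} (D : LPData d) (m : ℝ) (u : TD d) (k : ℕ) :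
    Measurable (lpWeight D m u k) :=
  measurable_const.mul (continuous_LPdist D k u).enorm.measurable

theorem two_rpow_eq_ofReal (s : ℝ) : (2:ℝ≥0∞) ^ s = ENNReal.ofReal ((2:ℝ) ^ s) := by
  rw [← ENNReal.ofReal_rpow_of_pos (by norm_num)]
  simp

theorem isCarleson_lpWeight {d : ℕ} (D : LPData d) (m : ℝ) (u : TD d)
    (hu : FinftyNormDist D m 1 u ≠ ⊤) :
    IsCarleson (lpWeight D m u) (FinftyNormDist D m 1 u) where
  ne_top := hu
  measurable := measurable_lpWeight D m u
  zero_le x := by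
    have h : (‖LPdist D 0 u x‖₊ : ℝ≥0∞) ≤ ⨆ x : RD d, (‖LPdist D 0 u x‖₊ : ℝ≥0∞) :=
      le_iSup (fun x => (‖LPdist D 0 u x‖₊ : ℝ≥0∞)) x
    refine le_trans ?_ (h.trans le_self_add)
    simp [lpWeight, enorm_eq_nnnorm]
  dyadic_le μ hμ n := by
    have h : cubePiece d μ n μ m 1 (fun k x => LPdist D k u x) ≤ FinftyNormDist D m 1 u := by
      refine le_trans ?_ le_add_self
      exact le_iSup_of_le μ (le_iSup_of_le hμ (le_iSup_of_le n le_rfl))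
    have e : cubePiece d μ n μ m 1 (fun k x => LPdist D k u x) =
        ENNReal.ofReal (((2:ℝ) ^ μ) ^ d) *
          ∫⁻ x in dyadicCube d μ n, ∑' j, lpWeight D m u (μ + j) x := by
      rw [cubePiece, div_one, ENNReal.rpow_one, two_rpow_eq_ofReal, Real.rpow_mul (by norm_num),
        Real.rpow_natCast, Real.rpow_natCast]
      congr 1
      refine lintegral_congr fun x => tsum_congr fun j => ?_
      rw [two_rpow_eq_ofReal, ENNReal.rpow_one, lpWeight, mul_one, enorm_eq_nnnorm,
        mul_comm m, Real.rpow_mul (by norm_num), ← Nat.cast_add, Real.rpow_natCast]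
    rw [e] at h
    refine le_trans (le_of_eq ?_) (mul_le_mul_right h _)
    rw [← mul_assoc, ← ENNReal.ofReal_mul (by positivity), ← mul_pow,
      inv_mul_cancel₀ (by positivity), one_pow, ENNReal.ofReal_one, one_mul]

/-- A kernel dominated by the decay weight acts on `Π_k u` with a bound by the smoothed weight. -/
theorem integrable_kernel_mul_LPdist {d : ℕ} (D : LPData d) (m : ℝ) (u : TD d) (L k : ℕ)
    (x : RD d) {κ : RD d → ℂ} {A : ℝ} (hA : 0 ≤ A) (hκ : AEStronglyMeasurable κ)
    (hb : ∀ z, ‖κ z‖ ≤ A * ((2:ℝ)^k) ^ m * decayWeight L k (x - z))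
    (hfin : smoothed L k (lpWeight D m u k) x ≠ ⊤) :
    Integrable (fun z => κ z * LPdist D k u z) ∧
    ‖∫ z, κ z * LPdist D k u z‖ₑ ≤ ENNReal.ofReal A * smoothed L k (lpWeight D m u k) x := by
  have h1 : ∫⁻ z, ‖κ z * LPdist D k u z‖ₑ ≤
      ENNReal.ofReal A * smoothed L k (lpWeight D m u k) x := by
    rw [smoothed, ← lintegral_const_mul' _ _ ENNReal.ofReal_ne_top]
    refine lintegral_mono fun z => ?_
    have h2 : ‖κ z‖ₑ ≤ ENNReal.ofReal A * ENNReal.ofReal (((2:ℝ)^k) ^ m) *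
        ENNReal.ofReal (decayWeight L k (x - z)) := by
      rw [← ENNReal.ofReal_mul hA, ← ENNReal.ofReal_mul (by positivity), ← ofReal_norm]
      exact ENNReal.ofReal_le_ofReal (hb z)
    rw [enorm_mul, lpWeight]
    refine (mul_le_mul_left h2 _).trans (le_of_eq (by ring))
  refine ⟨⟨hκ.mul (continuous_LPdist D k u).aestronglyMeasurable, ?_⟩,
    (enorm_integral_le_lintegral_enorm _).trans h1⟩
  exact h1.trans_lt (ENNReal.mul_lt_top ENNReal.ofReal_lt_top hfin.lt_top)

theorem IsSymbolS11.stronglyMeasurable_cutKernel {d : ℕ} {m : ℝ} {a : RD d → RD d → ℂ}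
    (ha : IsSymbolS11 d m a) (k : ℕ) :
    StronglyMeasurable fun p : RD d × RD d => cutKernel k (a p.1) p.2 := by
  have h1 : Continuous fun q : (RD d × RD d) × RD d => a q.1.1 q.2 :=
    ha.1.continuous.comp ((continuous_fst.comp continuous_fst).prodMk continuous_snd)
  have h2 : Continuous fun q : (RD d × RD d) × RD d => cutBump d k (((2:ℝ)^k)⁻¹ • q.2) :=
    (continuous_cutBump_dilate d k).comp continuous_snd
  have h3 : Continuous fun q : (RD d × RD d) × RD d => (Real.fourierChar ⟪q.1.2, q.2⟫ : ℂ) :=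
    Continuous.comp (g := fun p : RD d × RD d => (Real.fourierChar ⟪p.1, p.2⟫ : ℂ))
      (f := fun q : (RD d × RD d) × RD d => (q.1.2, q.2)) continuous_fourierChar_inner
      ((continuous_snd.comp continuous_fst).prodMk continuous_snd)
  exact ((h1.mul h2).mul h3).stronglyMeasurable.integral_prod_right'

/-- The kernel with its symbol averaged in `x` against `f` at scale `σ`. -/
def smearKernel {d : ℕ} (f : 𝓢(RD d, ℂ)) (a : RD d → RD d → ℂ) (k : ℕ) (σ : ℝ) (x z : RD d) : ℂ :=
  ∫ y, f y * cutKernel k (a (x - σ • y)) (x - z)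

theorem IsSymbolS11.stronglyMeasurable_smearKernel {d : ℕ} {m : ℝ} {a : RD d → RD d → ℂ}
    (ha : IsSymbolS11 d m a) (f : 𝓢(RD d, ℂ)) (k : ℕ) (σ : ℝ) :
    StronglyMeasurable fun p : RD d × RD d => smearKernel f a k σ p.1 p.2 := by
  have h1 : Continuous fun q : (RD d × RD d) × RD d => f q.2 := f.continuous.comp continuous_snd
  have h2 : Measurable fun q : (RD d × RD d) × RD d => (q.1.1 - σ • q.2, q.1.1 - q.1.2) := by
    fun_prop
  exact (h1.stronglyMeasurable.mul
    ((ha.stronglyMeasurable_cutKernel k).comp_measurable h2)).integral_prod_right'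

/-- The operator with kernel `smearKernel`, acting on `Π_k u`. -/
def smearPiece {d : ℕ} (D : LPData d) (f : 𝓢(RD d, ℂ)) (a : RD d → RD d → ℂ) (u : TD d) (k : ℕ)
    (σ : ℝ) (x : RD d) : ℂ :=
  ∫ z, smearKernel f a k σ x z * LPdist D k u z

theorem IsSymbolS11.stronglyMeasurable_smearPiece {d : ℕ} {m : ℝ} {a : RD d → RD d → ℂ}
    (ha : IsSymbolS11 d m a) (D : LPData d) (f : 𝓢(RD d, ℂ)) (u : TD d) (k : ℕ) (σ : ℝ) :
    StronglyMeasurable (smearPiece D f a u k σ) :=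
  StronglyMeasurable.integral_prod_right' (f := fun p : RD d × RD d =>
    smearKernel f a k σ p.1 p.2 * LPdist D k u p.2)
    ((ha.stronglyMeasurable_smearKernel f k σ).mul
      ((continuous_LPdist D k u).comp continuous_snd).stronglyMeasurable)

theorem IsSymbolS11.integrable_smearKernel_integrand {d : ℕ} {m : ℝ} {a : RD d → RD d → ℂ}
    (ha : IsSymbolS11 d m a) (f : 𝓢(RD d, ℂ)) (k : ℕ) (σ : ℝ) (x w : RD d) :
    Integrable fun y => f y * cutKernel k (a (x - σ • y)) w := by
  obtain ⟨C, -, hC, -⟩ := ha.exists_cutKernel_bounds 0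
  have hm : Measurable fun y : RD d => (x - σ • y, w) := by fun_prop
  refine f.integrable.mul_bdd (c := C * ((2:ℝ)^k) ^ m * decayWeight 0 k w)
    ((ha.stronglyMeasurable_cutKernel k).comp_measurable hm).aestronglyMeasurable
    (Eventually.of_forall fun y => hC k _ w)

theorem IsSymbolS11.norm_smearKernel_le {d : ℕ} {m : ℝ} {a : RD d → RD d → ℂ}
    (f : 𝓢(RD d, ℂ)) {k L : ℕ} {C : ℝ}
    (hC : ∀ x w, ‖cutKernel k (a x) w‖ ≤ C * ((2:ℝ)^k) ^ m * decayWeight L k w)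
    (σ : ℝ) (x z : RD d) :
    ‖smearKernel f a k σ x z‖ ≤ ((∫ y, ‖f y‖) * C) * ((2:ℝ)^k) ^ m * decayWeight L k (x - z) := by
  refine (norm_integral_le_of_norm_le (f.integrable.norm.mul_const
    (C * ((2:ℝ)^k) ^ m * decayWeight L k (x - z))) (Eventually.of_forall fun y => ?_)).trans
    (le_of_eq ?_)
  · rw [norm_mul]
    exact mul_le_mul_of_nonneg_left (hC _ _) (norm_nonneg _)
  · rw [integral_mul_const]
    ring

theorem IsSymbolS11.norm_smearKernel_sub_le {d : ℕ} {m : ℝ} {a : RD d → RD d → ℂ}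
    (ha : IsSymbolS11 d m a) (f : 𝓢(RD d, ℂ)) {k L : ℕ} {C : ℝ}
    (hC : ∀ x x' w, ‖cutKernel k (a x) w - cutKernel k (a x') w‖ ≤
      C * ((2:ℝ)^k) ^ m * (2 ^ k * ‖x - x'‖) * decayWeight L k w)
    (σ : ℝ) (x z : RD d) :
    ‖smearKernel f a k σ x z - smearKernel f a k 0 x z‖ ≤
      ((∫ y, (1 + ‖y‖) ^ 1 * ‖f y‖) * |C| * |σ| * 2 ^ k) * ((2:ℝ)^k) ^ m *
        decayWeight L k (x - z) := by
  rw [smearKernel, smearKernel, ← integral_sub (ha.integrable_smearKernel_integrand f k σ x _)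
    (ha.integrable_smearKernel_integrand f k 0 x _)]
  refine (norm_integral_le_of_norm_le ((integrable_one_add_norm_pow_mul_schwartz f 1).mul_const
    (|C| * ((2:ℝ)^k) ^ m * (2 ^ k * |σ|) * decayWeight L k (x - z)))
    (Eventually.of_forall fun y => ?_)).trans (le_of_eq ?_)
  · rw [← mul_sub, norm_mul]
    refine (mul_le_mul_of_nonneg_left (hC _ _ _) (norm_nonneg (f y))).trans ?_
    have e : ‖x - σ • y - (x - (0:ℝ) • y)‖ = |σ| * ‖y‖ := by
      rw [zero_smul, sub_zero, sub_sub_cancel_left, norm_neg, norm_smul, Real.norm_eq_abs]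
    rw [e]
    have hW := decayWeight_nonneg L k (x - z)
    have hy : ‖y‖ ≤ (1 + ‖y‖) ^ 1 := by rw [pow_one]; linarith
    have h1 : C * ((2:ℝ)^k) ^ m * (2 ^ k * (|σ| * ‖y‖)) * decayWeight L k (x - z) =
      C * (((2:ℝ)^k) ^ m * (2 ^ k * |σ|) * decayWeight L k (x - z) * ‖y‖) := by ring
    rw [h1]
    calc _ ≤ ‖f y‖ * (|C| * (((2:ℝ)^k) ^ m * (2 ^ k * |σ|) * decayWeight L k (x - z) *
          (1 + ‖y‖) ^ 1)) := by
          refine mul_le_mul_of_nonneg_left (mul_le_mul (le_abs_self C) ?_ (by positivity)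
            (abs_nonneg C)) (norm_nonneg _)
          exact mul_le_mul_of_nonneg_left hy (by positivity)
      _ = _ := by ring
  · rw [integral_mul_const]
    ring

theorem smearKernel_zero {d : ℕ} (D : LPData d) (a : RD d → RD d → ℂ) (k : ℕ) (x z : RD d) :
    smearKernel D.Φ a k 0 x z = cutKernel k (a x) (x - z) := by
  simp only [smearKernel, zero_smul, sub_zero]
  rw [integral_mul_const, D.integral_Φ, one_mul]

theorem IsSymbolS11.aestronglyMeasurable_smearKernel {d : ℕ} {m : ℝ} {a : RD d → RD d → ℂ}
    (ha : IsSymbolS11 d m a) (f : 𝓢(RD d, ℂ)) (k : ℕ) (σ : ℝ) (x : RD d) :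
    AEStronglyMeasurable (fun z => smearKernel f a k σ x z) :=
  ((ha.stronglyMeasurable_smearKernel f k σ).comp_measurable
    (measurable_const.prodMk measurable_id)).aestronglyMeasurable

theorem IsSymbolS11.exists_smearPiece_bounds {d : ℕ} {m : ℝ} {a : RD d → RD d → ℂ}
    (ha : IsSymbolS11 d m a) (D : LPData d) (L : ℕ) : ∃ C : ℝ, 0 ≤ C ∧ ∀ (u : TD d) (k : ℕ),
      (∀ x, smoothed L k (lpWeight D m u k) x ≠ ⊤) →
      (∀ σ x, ‖smearPiece D D.Φ a u k σ x‖ₑ ≤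
        ENNReal.ofReal C * smoothed L k (lpWeight D m u k) x) ∧
      (∀ σ x, ‖smearPiece D D.Φ a u k σ x - smearPiece D D.Φ a u k 0 x‖ₑ ≤
        ENNReal.ofReal (C * |σ| * 2 ^ k) * smoothed L k (lpWeight D m u k) x) ∧
      ∀ x x' ρ, 2 ^ k * ‖x - x'‖ ≤ ρ →
        ‖smearPiece D D.Φ a u k 0 x - smearPiece D D.Φ a u k 0 x'‖ₑ ≤
          ENNReal.ofReal (C * (1 + ρ) ^ L * (2 ^ k * ‖x - x'‖)) *
            smoothed L k (lpWeight D m u k) x := by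
  obtain ⟨C, hC0, hC1, hC2, hC3⟩ := ha.exists_cutKernel_bounds L
  set A : ℝ := ∫ y, ‖D.Φ y‖
  set B : ℝ := ∫ y, (1 + ‖y‖) ^ 1 * ‖D.Φ y‖
  have hA : 0 ≤ A := integral_nonneg fun y => norm_nonneg _
  have hB : 0 ≤ B := integral_nonneg fun y => by positivity
  refine ⟨A * C + B * C + C, by positivity, fun u k hfin => ?_⟩
  have key : ∀ σ x, Integrable (fun z => smearKernel D.Φ a k σ x z * LPdist D k u z) ∧ _ :=
    fun σ x => integrable_kernel_mul_LPdist D m u L k x (mul_nonneg hA hC0)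
      (ha.aestronglyMeasurable_smearKernel D.Φ k σ x)
      (fun z => IsSymbolS11.norm_smearKernel_le D.Φ (hC1 k) σ x z) (hfin x)
  refine ⟨fun σ x => ?_, fun σ x => ?_, fun x x' ρ hρ => ?_⟩
  · refine (key σ x).2.trans ?_
    gcongr
    linarith [mul_nonneg hB hC0]
  · rw [smearPiece, smearPiece, ← integral_sub (key σ x).1 (key 0 x).1]
    simp_rw [← sub_mul]
    refine (integrable_kernel_mul_LPdist D m u L k x (A := B * |C| * |σ| * 2 ^ k) (by positivity)
      ((ha.aestronglyMeasurable_smearKernel D.Φ k σ x).sub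
        (ha.aestronglyMeasurable_smearKernel D.Φ k 0 x))
      (fun z => ha.norm_smearKernel_sub_le D.Φ (hC2 k) σ x z) (hfin x)).2.trans ?_
    rw [abs_of_nonneg hC0]
    gcongr
    linarith [mul_nonneg hA hC0]
  · have hρ0 : 0 ≤ ρ := le_trans (by positivity) hρ
    rw [smearPiece, smearPiece, ← integral_sub (key 0 x).1 (key 0 x').1]
    simp_rw [← sub_mul]
    refine (integrable_kernel_mul_LPdist D m u L k x
      (A := C * (1 + ρ) ^ L * (2 ^ k * ‖x - x'‖)) (by positivity)
      ((ha.aestronglyMeasurable_smearKernel D.Φ k 0 x).sub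
        (ha.aestronglyMeasurable_smearKernel D.Φ k 0 x'))
      (fun z => ?_) (hfin x)).2.trans ?_
    · change ‖smearKernel D.Φ a k 0 x z - smearKernel D.Φ a k 0 x' z‖ ≤ _
      rw [smearKernel_zero, smearKernel_zero]
      refine (hC3 k x x' z ρ hρ).trans (le_of_eq (by ring))
    · gcongr
      linarith [mul_nonneg hB hC0, mul_nonneg hA hC0]

/-- The partial sums of the operator in terms of averaged kernels. -/
theorem IsSymbolS11.pdoPartial_eq_sum {d : ℕ} {m : ℝ} {a : RD d → RD d → ℂ}
    (ha : IsSymbolS11 d m a) (D : LPData d) (L : ℕ) (u : TD d)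
    (hfin : ∀ k x, smoothed L k (lpWeight D m u k) x ≠ ⊤) (N : ℕ) (x : RD d) :
    pdoPartial D a N u x =
      ∑ k ∈ Finset.range (N + 1), smearPiece D D.Φ a u k ((2:ℝ)^N)⁻¹ x := by
  obtain ⟨C, hC0, hC1, -⟩ := ha.exists_cutKernel_bounds L
  rw [pdoPartial, Finset.sum_comm]
  refine Finset.sum_congr rfl fun k _ => ?_
  have h1 : ∀ j, pdoPieceD D a j k u x =
      ∫ z, smearKernel (LPkernelS D j) a k 1 x z * LPdist D k u z := by
    intro j
    rw [pdoPieceD_eq_integral D ha]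
    simp only [smearKernel, one_smul]
  simp_rw [h1]
  rw [← integral_finsetSum, smearPiece]
  · refine integral_congr_ae (Eventually.of_forall fun z => ?_)
    simp only [← Finset.sum_mul]
    congr 1
    simp only [smearKernel]
    rw [← integral_finsetSum _ fun j _ =>
      ha.integrable_smearKernel_integrand (LPkernelS D j) k 1 x (x - z)]
    simp only [← Finset.sum_mul, one_smul]
    rw [← integral_scaleS_mul N D.Φ fun y => cutKernel k (a (x - y)) (x - z), ← sum_LPkernelS]
    simp
  · exact fun j _ => (integrable_kernel_mul_LPdist D m u L k x
      (mul_nonneg (integral_nonneg fun y => norm_nonneg _) hC0)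
      (ha.aestronglyMeasurable_smearKernel (LPkernelS D j) k 1 x)
      (fun z => IsSymbolS11.norm_smearKernel_le (LPkernelS D j) (hC1 k) 1 x z) (hfin k x)).1

/-- The constant in the bounds over cubes of side at least one. -/
def largeCubeConst (d L : ℕ) : ℝ≥0∞ := decayMass d L + ENNReal.ofReal (3 ^ d) * decayMass d L

theorem largeCubeConst_ne_top {d L : ℕ} (hL : 2 * d < L) : largeCubeConst d L ≠ ⊤ :=
  ENNReal.add_ne_top.2 ⟨decayMass_ne_top hL,
    ENNReal.mul_ne_top ENNReal.ofReal_ne_top (decayMass_ne_top hL)⟩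

theorem IsCarleson.lintegral_cube_tsum_smoothed {d : ℕ} {h : ℕ → RD d → ℝ≥0∞} {H : ℝ≥0∞}
    (hC : IsCarleson h H) (L : ℕ) (c : RD d) {ℓ : ℝ} (hℓ : 1 ≤ ℓ) :
    ∫⁻ x in cube d c ℓ, ∑' k, smoothed L k (h k) x ≤
      ENNReal.ofReal (ℓ ^ d) * (largeCubeConst d L * H) := by
  have e : ∀ x, ∑' k, smoothed L k (h k) x =
      smoothed L 0 (h 0) x + ∑' j, smoothed L (1 + j) (h (1 + j)) x := by
    intro x
    have := tsum_eq_zero_add' (f := fun k => smoothed L k (h k) x) ENNReal.summable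
    simp only [add_comm 1]
    exact this
  simp_rw [e]
  rw [lintegral_add_left (measurable_smoothed L 0 (hC.measurable 0))]
  have h1 : ∫⁻ x in cube d c ℓ, smoothed L 0 (h 0) x ≤
      decayMass d L * H * ENNReal.ofReal (ℓ ^ d) := by
    refine (lintegral_mono fun x => hC.smoothed_zero_le L x).trans (le_of_eq ?_)
    rw [setLIntegral_const, volume_cube _ _ (by linarith)]
  have h2 := hC.lintegral_cube_smoothed L le_rfl c (R := 2 * ℓ) (by linarith)
  have e2 : 2 * ℓ * ((2:ℝ) ^ 1)⁻¹ = ℓ := by ring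
  rw [e2, mul_pow, ENNReal.ofReal_mul (by positivity)] at h2
  refine (add_le_add h1 h2).trans (le_of_eq ?_)
  rw [largeCubeConst]
  ring

theorem one_add_norm_inv_pow_le {d : ℕ} (M : ℕ) (x : RD d) :
    ENNReal.ofReal (((1 + ‖x‖) ^ M)⁻¹) ≤ ∑' n : ℕ, ENNReal.ofReal ((2:ℝ) ^ M * ((2 ^ n) ^ M)⁻¹) *
      (cube d (WithLp.toLp 2 fun _ => -(2:ℝ) ^ n) (2 * 2 ^ n)).indicator 1 x := by
  obtain ⟨n, h1, h2⟩ := exists_nat_pow_near (x := 1 + ‖x‖) (y := (2:ℝ))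
    (le_add_of_nonneg_right (norm_nonneg x)) (by norm_num)
  have hx : x ∈ cube d (WithLp.toLp 2 fun _ => -(2:ℝ) ^ (n + 1)) (2 * 2 ^ (n + 1)) := by
    intro i
    have h3 := abs_le.1 (PiLp.norm_apply_le x i)
    simp only
    constructor <;> linarith
  refine le_trans ?_ (ENNReal.le_tsum (n + 1))
  rw [Set.indicator_of_mem hx, Pi.one_apply, mul_one]
  refine ENNReal.ofReal_le_ofReal ?_
  rw [pow_succ, mul_pow, mul_inv, mul_left_comm, mul_inv_cancel₀ (by positivity), mul_one]
  gcongr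

theorem IsCarleson.lintegral_tsum_smoothed_mul_lt_top {d : ℕ} {h : ℕ → RD d → ℝ≥0∞} {H : ℝ≥0∞}
    (hC : IsCarleson h H) {L : ℕ} (hL : 2 * d < L) :
    ∫⁻ x, (∑' k, smoothed L k (h k) x) * ENNReal.ofReal (((1 + ‖x‖) ^ (d + 1))⁻¹) < ⊤ := by
  set A : ℝ≥0∞ := largeCubeConst d L * H
  have hA : A ≠ ⊤ := ENNReal.mul_ne_top (largeCubeConst_ne_top hL) hC.ne_top
  set G : RD d → ℝ≥0∞ := fun x => ∑' k, smoothed L k (h k) x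
  have hG : Measurable G := Measurable.tsum fun k => measurable_smoothed L k (hC.measurable k)
  set Q : ℕ → Set (RD d) := fun n => cube d (WithLp.toLp 2 fun _ => -(2:ℝ) ^ n) (2 * 2 ^ n)
  have hQ : ∀ n, MeasurableSet (Q n) := fun n => measurableSet_cube _ _ _
  set w : ℕ → ℝ≥0∞ := fun n => ENNReal.ofReal ((2:ℝ) ^ (d + 1) * ((2 ^ n) ^ (d + 1))⁻¹)
  have e : ∀ x n, G x * (w n * (Q n).indicator 1 x) = w n * (Q n).indicator G x := by
    intro x n
    by_cases hx : x ∈ Q n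
    · rw [Set.indicator_of_mem hx, Set.indicator_of_mem hx, Pi.one_apply]
      ring
    · rw [Set.indicator_of_notMem hx, Set.indicator_of_notMem hx]
      ring
  calc ∫⁻ x, G x * ENNReal.ofReal (((1 + ‖x‖) ^ (d + 1))⁻¹)
      ≤ ∫⁻ x, ∑' n, w n * (Q n).indicator G x := by
        refine lintegral_mono fun x => ?_
        refine (mul_le_mul_right (one_add_norm_inv_pow_le (d + 1) x) (G x)).trans (le_of_eq ?_)
        rw [← ENNReal.tsum_mul_left]
        exact tsum_congr fun n => e x n
    _ = ∑' n, w n * ∫⁻ x in Q n, G x := by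
        rw [lintegral_tsum fun n => ((hG.indicator (hQ n)).const_mul _).aemeasurable]
        refine tsum_congr fun n => ?_
        rw [lintegral_const_mul' _ _ ENNReal.ofReal_ne_top, lintegral_indicator (hQ n)]
    _ ≤ ∑' n : ℕ, ENNReal.ofReal ((2:ℝ) ^ (2 * d + 1)) * A * (2⁻¹ : ℝ≥0∞) ^ n := by
        refine ENNReal.tsum_le_tsum fun n => ?_
        have h1 : (1:ℝ) ≤ 2 * 2 ^ n := by
          have : (1:ℝ) ≤ 2 ^ n := one_le_pow₀ (by norm_num)
          linarith
        refine (mul_le_mul_right (hC.lintegral_cube_tsum_smoothed L _ h1) _).trans (le_of_eq ?_)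
        have e2 : (2⁻¹ : ℝ≥0∞) ^ n = ENNReal.ofReal ((2 ^ n)⁻¹) := by
          rw [ENNReal.ofReal_inv_of_pos (by positivity), ENNReal.ofReal_pow (by norm_num),
            ENNReal.inv_pow]
          simp
        rw [← mul_assoc, e2, ← ENNReal.ofReal_mul (by positivity), mul_right_comm (ENNReal.ofReal _),
          ← ENNReal.ofReal_mul (by positivity)]
        congr 2
        rw [mul_pow, pow_succ ((2:ℝ) ^ n), mul_inv]
        have : ((2:ℝ) ^ n) ^ d ≠ 0 := by positivity
        field_simp
        ring
    _ < ⊤ := by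
        rw [ENNReal.tsum_mul_left, ENNReal.tsum_geometric]
        refine ENNReal.mul_lt_top (ENNReal.mul_lt_top ENNReal.ofReal_lt_top hA.lt_top) ?_
        rw [ENNReal.one_sub_inv_two, inv_inv]
        exact ENNReal.ofNat_lt_top

theorem lintegral_sub_cubeMean_le {d : ℕ} {g : RD d → ℂ} {c : RD d} {ℓ : ℝ} (hℓ : 0 < ℓ)
    (hg : IntegrableOn g (cube d c ℓ)) (b : ℂ) :
    ∫⁻ x in cube d c ℓ, ‖g x - cubeMean c ℓ g‖ₑ ≤ 2 * ∫⁻ x in cube d c ℓ, ‖g x - b‖ₑ := by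
  have hv := volume_cube d c hℓ.le
  have hfin : volume (cube d c ℓ) ≠ ⊤ := by rw [hv]; exact ENNReal.ofReal_ne_top
  have hpos : (0:ℝ) < ℓ ^ d := by positivity
  have h1 : b - cubeMean c ℓ g = (ℓ ^ d)⁻¹ • ∫ x in cube d c ℓ, (b - g x) := by
    have hb : IntegrableOn (fun _ => b) (cube d c ℓ) := integrableOn_const hfin
    rw [integral_sub hb.integrable hg.integrable, setIntegral_const, measureReal_def, hv,
      ENNReal.toReal_ofReal hpos.le, smul_sub, smul_smul, inv_mul_cancel₀ hpos.ne', one_smul]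
    rfl
  have h2 : ‖b - cubeMean c ℓ g‖ₑ * volume (cube d c ℓ) ≤ ∫⁻ x in cube d c ℓ, ‖g x - b‖ₑ := by
    rw [h1, enorm_smul, hv, mul_comm, ← mul_assoc, Real.enorm_of_nonneg (by positivity),
      ← ENNReal.ofReal_mul hpos.le, mul_inv_cancel₀ hpos.ne', ENNReal.ofReal_one, one_mul]
    refine (enorm_integral_le_lintegral_enorm _).trans (le_of_eq ?_)
    refine lintegral_congr fun x => ?_
    rw [← enorm_neg, neg_sub]
  calc ∫⁻ x in cube d c ℓ, ‖g x - cubeMean c ℓ g‖ₑ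
      ≤ ∫⁻ x in cube d c ℓ, (‖g x - b‖ₑ + ‖b - cubeMean c ℓ g‖ₑ) := by
        refine lintegral_mono fun x => ?_
        rw [← sub_add_sub_cancel (g x) b]
        exact enorm_add_le _ _
    _ = (∫⁻ x in cube d c ℓ, ‖g x - b‖ₑ) + ‖b - cubeMean c ℓ g‖ₑ * volume (cube d c ℓ) := by
        rw [lintegral_add_right _ measurable_const, setLIntegral_const]
    _ ≤ _ := by
        rw [two_mul]
        gcongr

theorem enorm_tsum_sub_le (t s : ℕ → ℂ) (μ : ℕ) :
    ‖(∑' k, t k) - ∑ k ∈ Finset.range μ, s k‖ₑ ≤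
      ∑ k ∈ Finset.range μ, ‖t k - s k‖ₑ + ∑' j, ‖t (μ + j)‖ₑ := by
  by_cases h : ∑' j, ‖t (μ + j)‖ₑ = ⊤
  · rw [h, add_top]
    exact le_top
  have hs : Summable t := by
    rw [← summable_nat_add_iff μ]
    refine Summable.of_enorm ?_
    simpa only [add_comm] using h
  rw [← hs.sum_add_tsum_nat_add μ, add_sub_right_comm, ← Finset.sum_sub_distrib]
  refine (enorm_add_le _ _).trans (add_le_add (enorm_sum_le _ _) ?_)
  simp_rw [add_comm μ]
  exact enorm_tsum_le_tsum_enorm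

/-- The constant in the mean oscillation bounds over cubes of side less than one. -/
def smallCubeConst (d L : ℕ) (C : ℝ) : ℝ≥0∞ :=
  ENNReal.ofReal (C * (1 + 2 * d) ^ L * (2 * d)) * smoothedConst d L +
    ENNReal.ofReal C * (ENNReal.ofReal (3 ^ d) * decayMass d L)

theorem smallCubeConst_ne_top {d L : ℕ} (hL : 2 * d < L) (C : ℝ) : smallCubeConst d L C ≠ ⊤ :=
  ENNReal.add_ne_top.2 ⟨ENNReal.mul_ne_top ENNReal.ofReal_ne_top (smoothedConst_ne_top hL),
    ENNReal.mul_ne_top ENNReal.ofReal_ne_top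
      (ENNReal.mul_ne_top ENNReal.ofReal_ne_top (decayMass_ne_top hL))⟩

theorem sum_range_two_pow_div_le (μ : ℕ) :
    ∑ k ∈ Finset.range μ, (2:ℝ) ^ k * (2 ^ μ)⁻¹ ≤ 1 := by
  rw [← Finset.sum_mul, geom_sum_eq (by norm_num), ← div_eq_mul_inv, div_le_one (by positivity)]
  linarith

theorem IsCarleson.exists_lintegral_cube_sub_le {d : ℕ} {h : ℕ → RD d → ℝ≥0∞} {H : ℝ≥0∞}
    (hC : IsCarleson h H) (L : ℕ) {C : ℝ} (hC0 : 0 ≤ C) {t : ℕ → RD d → ℂ}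
    (ht : ∀ k x, ‖t k x‖ₑ ≤ ENNReal.ofReal C * smoothed L k (h k) x)
    (htd : ∀ k x x' ρ, 2 ^ k * ‖x - x'‖ ≤ ρ → ‖t k x - t k x'‖ₑ ≤
      ENNReal.ofReal (C * (1 + ρ) ^ L * (2 ^ k * ‖x - x'‖)) * smoothed L k (h k) x)
    (c : RD d) {ℓ : ℝ} (hℓ : 0 < ℓ) (hℓ1 : ℓ < 1) :
    ∃ b : ℂ, ∫⁻ x in cube d c ℓ, ‖(∑' k, t k x) - b‖ₑ ≤
      ENNReal.ofReal (ℓ ^ d) * (smallCubeConst d L C * H) := by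
  obtain ⟨n, hn1, hn2⟩ := exists_nat_pow_near_of_lt_one hℓ hℓ1.le (y := (1/2:ℝ))
    (by norm_num) (by norm_num)
  set μ := n + 1 with hμ
  have hp : (0:ℝ) < 2 ^ μ := by positivity
  have h1 : ((2:ℝ) ^ μ)⁻¹ ≤ ℓ := by
    rw [one_div, inv_pow] at hn1
    exact hn1.le
  have h2 : ℓ ≤ 2 * ((2:ℝ) ^ μ)⁻¹ := by
    refine hn2.trans (le_of_eq ?_)
    rw [hμ, pow_succ, one_div, inv_pow, mul_inv]
    ring
  set A := ENNReal.ofReal (C * (1 + 2 * d) ^ L * (2 * d)) with hA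
  have hc : c ∈ cube d c ℓ := fun i => ⟨le_rfl, by linarith⟩
  have hlow : ∀ x ∈ cube d c ℓ, ∑ k ∈ Finset.range μ, ‖t k x - t k c‖ₑ ≤
      A * (smoothedConst d L * H) := by
    intro x hx
    have hxc : ‖x - c‖ ≤ 2 * d * ((2:ℝ) ^ μ)⁻¹ := by
      refine (norm_sub_le_of_mem_cube hℓ.le hx hc).trans ?_
      calc (d:ℝ) * ℓ ≤ d * (2 * ((2:ℝ) ^ μ)⁻¹) := by gcongr
        _ = _ := by ring
    have hterm : ∀ k ∈ Finset.range μ, ‖t k x - t k c‖ₑ ≤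
        ENNReal.ofReal ((2:ℝ) ^ k * (2 ^ μ)⁻¹) * (A * (smoothedConst d L * H)) := by
      intro k hk
      have hkμ : (2:ℝ) ^ k ≤ 2 ^ μ :=
        pow_le_pow_right₀ (by norm_num) (Finset.mem_range.1 hk).le
      have h3 : 2 ^ k * ‖x - c‖ ≤ 2 * d * ((2:ℝ) ^ k * (2 ^ μ)⁻¹) := by
        calc 2 ^ k * ‖x - c‖ ≤ 2 ^ k * (2 * d * ((2:ℝ) ^ μ)⁻¹) := by gcongr
          _ = _ := by ring
      have h4 : (2:ℝ) ^ k * (2 ^ μ)⁻¹ ≤ 1 := by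
        rw [← div_eq_mul_inv, div_le_one hp]
        exact hkμ
      have h5 : 2 ^ k * ‖x - c‖ ≤ 2 * d := h3.trans (mul_le_of_le_one_right (by positivity) h4)
      refine (htd k x c (2 * d) h5).trans ?_
      rw [hA, ← mul_assoc (ENNReal.ofReal _) (ENNReal.ofReal _), ← ENNReal.ofReal_mul (by positivity)]
      refine mul_le_mul' (ENNReal.ofReal_le_ofReal ?_) (hC.smoothed_le_const L k x)
      calc C * (1 + 2 * d) ^ L * (2 ^ k * ‖x - c‖)
          ≤ C * (1 + 2 * d) ^ L * (2 * d * ((2:ℝ) ^ k * (2 ^ μ)⁻¹)) :=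
            mul_le_mul_of_nonneg_left h3 (by positivity)
        _ = _ := by ring
    refine (Finset.sum_le_sum hterm).trans ?_
    rw [← Finset.sum_mul, ← ENNReal.ofReal_sum_of_nonneg fun k _ => by positivity]
    refine mul_le_of_le_one_left' ?_
    rw [ENNReal.ofReal_le_one]
    exact sum_range_two_pow_div_le μ
  have hhigh : ∫⁻ x in cube d c ℓ, ∑' j, ‖t (μ + j) x‖ₑ ≤ ENNReal.ofReal C *
      (ENNReal.ofReal ((3 * ℓ) ^ d) * (decayMass d L * H)) := by
    have h3 := hC.lintegral_cube_smoothed L (μ := μ) (by omega) c (R := ℓ * 2 ^ μ) (by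
      rwa [inv_le_iff_one_le_mul₀ hp] at h1)
    rw [mul_assoc, mul_inv_cancel₀ hp.ne', mul_one] at h3
    refine le_trans ?_ (mul_le_mul_right h3 _)
    rw [← lintegral_const_mul' _ _ ENNReal.ofReal_ne_top]
    refine lintegral_mono fun x => ?_
    rw [← ENNReal.tsum_mul_left]
    exact ENNReal.tsum_le_tsum fun j => ht _ _
  refine ⟨∑ k ∈ Finset.range μ, t k c, ?_⟩
  calc ∫⁻ x in cube d c ℓ, ‖(∑' k, t k x) - ∑ k ∈ Finset.range μ, t k c‖ₑ
      ≤ ∫⁻ x in cube d c ℓ, (A * (smoothedConst d L * H) + ∑' j, ‖t (μ + j) x‖ₑ) := by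
        refine setLIntegral_mono' (measurableSet_cube d c ℓ) fun x hx => ?_
        refine (enorm_tsum_sub_le (fun k => t k x) (fun k => t k c) μ).trans ?_
        gcongr
        exact hlow x hx
    _ = A * (smoothedConst d L * H) * ENNReal.ofReal (ℓ ^ d) +
        ∫⁻ x in cube d c ℓ, ∑' j, ‖t (μ + j) x‖ₑ := by
        rw [lintegral_add_left measurable_const, setLIntegral_const, volume_cube _ _ hℓ.le]
    _ ≤ _ := by
        refine (add_le_add_right hhigh _).trans (le_of_eq ?_)
        rw [mul_pow, ENNReal.ofReal_mul (by positivity), smallCubeConst]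
        ring

theorem IsCarleson.lintegral_enorm_tsum_le {d : ℕ} {h : ℕ → RD d → ℝ≥0∞} {H : ℝ≥0∞}
    (hC : IsCarleson h H) (L : ℕ) {C : ℝ} {t : ℕ → RD d → ℂ}
    (ht : ∀ k x, ‖t k x‖ₑ ≤ ENNReal.ofReal C * smoothed L k (h k) x)
    (c : RD d) {ℓ : ℝ} (hℓ : 1 ≤ ℓ) :
    ∫⁻ x in cube d c ℓ, ‖∑' k, t k x‖ₑ ≤
      ENNReal.ofReal (ℓ ^ d) * (ENNReal.ofReal C * largeCubeConst d L * H) := by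
  calc ∫⁻ x in cube d c ℓ, ‖∑' k, t k x‖ₑ
      ≤ ∫⁻ x in cube d c ℓ, ENNReal.ofReal C * ∑' k, smoothed L k (h k) x := by
        refine lintegral_mono fun x => enorm_tsum_le_tsum_enorm.trans ?_
        rw [← ENNReal.tsum_mul_left]
        exact ENNReal.tsum_le_tsum fun k => ht k x
    _ ≤ _ := by
        rw [lintegral_const_mul' _ _ ENNReal.ofReal_ne_top]
        refine (mul_le_mul_right (hC.lintegral_cube_tsum_smoothed L c hℓ) _).trans
          (le_of_eq (by ring))

theorem cube_subset_cube {d : ℕ} (c : RD d) {ℓ ℓ' : ℝ} (h : ℓ ≤ ℓ') :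
    cube d c ℓ ⊆ cube d c ℓ' := fun x hx i => ⟨(hx i).1, (hx i).2.trans (by linarith)⟩

theorem IsCarleson.integrableOn_cube_tsum {d : ℕ} {h : ℕ → RD d → ℝ≥0∞} {H : ℝ≥0∞}
    (hC : IsCarleson h H) {L : ℕ} (hL : 2 * d < L) {C : ℝ} {t : ℕ → RD d → ℂ}
    (htm : ∀ k, Measurable (t k))
    (ht : ∀ k x, ‖t k x‖ₑ ≤ ENNReal.ofReal C * smoothed L k (h k) x) (c : RD d) (ℓ : ℝ) :
    IntegrableOn (fun x => ∑' k, t k x) (cube d c ℓ) := by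
  refine IntegrableOn.mono_set ⟨(Measurable.tsum htm).aestronglyMeasurable, ?_⟩
    (cube_subset_cube c (le_max_left ℓ 1))
  refine (hC.lintegral_enorm_tsum_le L ht c (le_max_right ℓ 1)).trans_lt ?_
  exact ENNReal.mul_lt_top ENNReal.ofReal_lt_top (ENNReal.mul_lt_top
    (ENNReal.mul_lt_top ENNReal.ofReal_lt_top (largeCubeConst_ne_top hL).lt_top) hC.ne_top.lt_top)

theorem IsCarleson.locallyIntegrable_tsum {d : ℕ} {h : ℕ → RD d → ℝ≥0∞} {H : ℝ≥0∞}
    (hC : IsCarleson h H) {L : ℕ} (hL : 2 * d < L) {C : ℝ} {t : ℕ → RD d → ℂ}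
    (htm : ∀ k, Measurable (t k))
    (ht : ∀ k x, ‖t k x‖ₑ ≤ ENNReal.ofReal C * smoothed L k (h k) x) :
    LocallyIntegrable (fun x => ∑' k, t k x) := by
  refine locallyIntegrable_iff.2 fun K hK => ?_
  obtain ⟨R, hR⟩ := hK.isBounded.subset_closedBall 0
  refine (hC.integrableOn_cube_tsum hL htm ht (WithLp.toLp 2 fun _ => -R) (2 * R)).mono_set
    fun x hx i => ?_
  have h1 := abs_le.1 ((PiLp.norm_apply_le x i).trans (mem_closedBall_zero_iff.1 (hR hx)))
  simp only
  constructor <;> linarith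

theorem ofReal_inv_pow_mul_le {ℓ : ℝ} (hℓ : 0 < ℓ) (d : ℕ) {X Y : ℝ≥0∞}
    (h : X ≤ ENNReal.ofReal (ℓ ^ d) * Y) : ENNReal.ofReal ((ℓ ^ d)⁻¹) * X ≤ Y := by
  refine (mul_le_mul_right h _).trans (le_of_eq ?_)
  rw [← mul_assoc, ← ENNReal.ofReal_mul (by positivity), inv_mul_cancel₀ (by positivity),
    ENNReal.ofReal_one, one_mul]

/-- The `bmo` bound for a series whose terms are controlled by smoothed Carleson sequences. -/
theorem IsCarleson.bmoNorm_tsum_le {d : ℕ} {h : ℕ → RD d → ℝ≥0∞} {H : ℝ≥0∞}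
    (hC : IsCarleson h H) {L : ℕ} (hL : 2 * d < L) {C : ℝ} (hC0 : 0 ≤ C) {t : ℕ → RD d → ℂ}
    (htm : ∀ k, Measurable (t k))
    (ht : ∀ k x, ‖t k x‖ₑ ≤ ENNReal.ofReal C * smoothed L k (h k) x)
    (htd : ∀ k x x' ρ, 2 ^ k * ‖x - x'‖ ≤ ρ → ‖t k x - t k x'‖ₑ ≤
      ENNReal.ofReal (C * (1 + ρ) ^ L * (2 ^ k * ‖x - x'‖)) * smoothed L k (h k) x) :
    bmoNorm d (fun x => ∑' k, t k x) ≤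
      (ENNReal.ofReal C * largeCubeConst d L + 2 * smallCubeConst d L C) * H := by
  rw [bmoNorm, add_mul]
  refine add_le_add ?_ ?_
  · refine iSup_le fun c => iSup_le fun ℓ => iSup_le fun hℓ => ?_
    exact ofReal_inv_pow_mul_le (by linarith) d (hC.lintegral_enorm_tsum_le L ht c hℓ)
  · refine iSup_le fun c => iSup_le fun ℓ => iSup_le fun hℓ => iSup_le fun hℓ1 => ?_
    obtain ⟨b, hb⟩ := hC.exists_lintegral_cube_sub_le L hC0 ht htd c hℓ hℓ1
    refine ofReal_inv_pow_mul_le hℓ d ?_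
    refine (lintegral_sub_cubeMean_le hℓ (hC.integrableOn_cube_tsum hL htm ht c ℓ) b).trans ?_
    exact (mul_le_mul_right hb _).trans (le_of_eq (by ring))

theorem tendsto_sum_range_of_dominated {b : ℕ → ℝ} {s : ℕ → ℕ → ℂ} {t : ℕ → ℂ}
    (hb : Summable b) (hs : ∀ N k, ‖s N k‖ ≤ b k)
    (ht : ∀ k, Tendsto (fun N => s N k) atTop (nhds (t k))) :
    Tendsto (fun N => ∑ k ∈ Finset.range (N + 1), s N k) atTop (nhds (∑' k, t k)) := by
  have h := tendsto_tsum_of_dominated_convergence (𝓕 := atTop)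
    (f := fun N k => if k < N + 1 then s N k else 0) hb (g := t)
    (fun k => (ht k).congr' (by
      filter_upwards [eventually_ge_atTop k] with N hN
      rw [if_pos (by omega)]))
    (Eventually.of_forall fun N k => by
      split_ifs
      · exact hs N k
      · simpa using (norm_nonneg _).trans (hs N k))
  refine h.congr fun N => ?_
  rw [tsum_eq_sum (s := Finset.range (N + 1))]
  · exact Finset.sum_congr rfl fun k hk => if_pos (Finset.mem_range.1 hk)
  · exact fun k hk => if_neg (by simpa using hk)

theorem enorm_schwartz_le {d : ℕ} (n : ℕ) (ψ : 𝓢(RD d, ℂ)) (x : RD d) :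
    ‖ψ x‖ₑ ≤ ENNReal.ofReal (2 ^ n * ((Finset.Iic (n, 0)).sup
      (schwartzSeminormFamily ℂ (RD d) ℂ)) ψ) * ENNReal.ofReal (((1 + ‖x‖) ^ n)⁻¹) := by
  have h := SchwartzMap.one_add_le_sup_seminorm_apply (𝕜 := ℂ) (m := (n, 0)) (k := n) (n := 0)
    le_rfl le_rfl ψ x
  rw [norm_iteratedFDeriv_zero] at h
  rw [← ENNReal.ofReal_mul (by positivity), ← ofReal_norm]
  refine ENNReal.ofReal_le_ofReal ?_
  rw [← div_eq_mul_inv, le_div_iff₀ (by positivity), mul_comm]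
  exact h

theorem lintegral_mul_schwartz_le {d : ℕ} (n : ℕ) {G : RD d → ℝ≥0∞} (ψ : 𝓢(RD d, ℂ)) :
    ∫⁻ x, G x * ‖ψ x‖ₑ ≤ ENNReal.ofReal (2 ^ n * ((Finset.Iic (n, 0)).sup
      (schwartzSeminormFamily ℂ (RD d) ℂ)) ψ) *
        ∫⁻ x, G x * ENNReal.ofReal (((1 + ‖x‖) ^ n)⁻¹) := by
  rw [← lintegral_const_mul' _ _ ENNReal.ofReal_ne_top]
  refine lintegral_mono fun x => ?_
  calc G x * ‖ψ x‖ₑ ≤ G x * _ := mul_le_mul_right (enorm_schwartz_le n ψ x) _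
    _ = _ := by ring

theorem integrable_mul_schwartz {d : ℕ} {n : ℕ} {G : RD d → ℝ≥0∞}
    (hG : ∫⁻ x, G x * ENNReal.ofReal (((1 + ‖x‖) ^ n)⁻¹) < ⊤) {F : RD d → ℂ}
    (hF : Measurable F) (hFG : ∀ x, ‖F x‖ₑ ≤ G x) (ψ : 𝓢(RD d, ℂ)) :
    Integrable fun x => F x * ψ x := by
  refine ⟨(hF.mul ψ.continuous.measurable).aestronglyMeasurable, ?_⟩
  refine lt_of_le_of_lt (lintegral_mono fun x => ?_) (lt_of_le_of_lt
    (lintegral_mul_schwartz_le n (G := G) ψ) (ENNReal.mul_lt_top ENNReal.ofReal_lt_top hG))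
  rw [enorm_mul]
  exact mul_le_mul_left (hFG x) _

/-- A measurable function whose size is dominated by a weight that is integrable against a
negative power of `1 + ‖x‖` is a tempered distribution. -/
theorem exists_temperedDistribution_eq_integral {d : ℕ} {n : ℕ} {G : RD d → ℝ≥0∞}
    (hG : ∫⁻ x, G x * ENNReal.ofReal (((1 + ‖x‖) ^ n)⁻¹) < ⊤) {F : RD d → ℂ}
    (hF : Measurable F) (hFG : ∀ x, ‖F x‖ₑ ≤ G x) :
    ∃ T : TD d, ∀ ψ : 𝓢(RD d, ℂ), T ψ = ∫ x, F x * ψ x := by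
  have hInt := integrable_mul_schwartz hG hF hFG
  set W := ∫⁻ x, G x * ENNReal.ofReal (((1 + ‖x‖) ^ n)⁻¹)
  refine ⟨SchwartzMap.mkCLMtoNormedSpace (𝕜 := ℂ) (σ := RingHom.id ℂ)
    (fun ψ : 𝓢(RD d, ℂ) => ∫ x, F x * ψ x) (fun ψ χ => ?_) (fun c ψ => ?_)
    ⟨Finset.Iic (n, 0), 2 ^ n * W.toReal, by positivity, fun ψ => ?_⟩, fun ψ => rfl⟩
  · simp only [_root_.add_apply, mul_add]
    exact integral_add (hInt ψ) (hInt χ)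
  · simp only [_root_.smul_apply, RingHom.id_apply, smul_eq_mul]
    rw [← integral_const_mul]
    exact integral_congr_ae (Eventually.of_forall fun x => by ring)
  · set p := ((Finset.Iic (n, 0)).sup (schwartzSeminormFamily ℂ (RD d) ℂ)) ψ
    have hp : 0 ≤ p := apply_nonneg _ _
    have h : ‖∫ x, F x * ψ x‖ₑ ≤ ENNReal.ofReal (2 ^ n * p) * W := by
      refine (enorm_integral_le_lintegral_enorm _).trans
        (le_trans (lintegral_mono fun x => ?_) (lintegral_mul_schwartz_le n (G := G) ψ))
      rw [enorm_mul]
      exact mul_le_mul_left (hFG x) _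
    have h' := ENNReal.toReal_mono (ENNReal.mul_ne_top ENNReal.ofReal_ne_top hG.ne) h
    rw [toReal_enorm, ENNReal.toReal_mul, ENNReal.toReal_ofReal (by positivity)] at h'
    linarith

theorem tendsto_integral_mul_schwartz {d : ℕ} {n : ℕ} {G : RD d → ℝ≥0∞} (hGm : Measurable G)
    (hG : ∫⁻ x, G x * ENNReal.ofReal (((1 + ‖x‖) ^ n)⁻¹) < ⊤) {F : ℕ → RD d → ℂ} {g : RD d → ℂ}
    (hF : ∀ N, Measurable (F N)) (hFG : ∀ N x, ‖F N x‖ₑ ≤ G x)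
    (hlim : ∀ x, G x ≠ ⊤ → Tendsto (fun N => F N x) atTop (nhds (g x))) (ψ : 𝓢(RD d, ℂ)) :
    Tendsto (fun N => ∫ x, F N x * ψ x) atTop (nhds (∫ x, g x * ψ x)) := by
  have hw : ∀ x : RD d, ENNReal.ofReal (((1 + ‖x‖) ^ n)⁻¹) ≠ 0 := fun x => by
    rw [Ne, ENNReal.ofReal_eq_zero, not_le]
    positivity
  have hae : ∀ᵐ x, G x ≠ ⊤ := by
    filter_upwards [ae_lt_top (hGm.mul (by fun_prop)) hG.ne] with x hx h
    rw [Pi.mul_apply, h, ENNReal.top_mul (hw x)] at hx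
    exact lt_irrefl _ hx
  have hfin : ∫⁻ x, G x * ‖ψ x‖ₑ ≠ ⊤ := (lt_of_le_of_lt
    (lintegral_mul_schwartz_le n (G := G) ψ) (ENNReal.mul_lt_top ENNReal.ofReal_lt_top hG)).ne
  refine tendsto_integral_of_dominated_convergence (fun x => (G x * ‖ψ x‖ₑ).toReal)
    (fun N => ((hF N).mul ψ.continuous.measurable).aestronglyMeasurable)
    (integrable_toReal_of_lintegral_ne_top
      (hGm.mul ψ.continuous.measurable.enorm).aemeasurable hfin) (fun N => ?_) ?_
  · filter_upwards [hae] with x hx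
    rw [← toReal_enorm, enorm_mul]
    exact ENNReal.toReal_mono (ENNReal.mul_ne_top hx enorm_ne_top) (mul_le_mul_left (hFG N x) _)
  · filter_upwards [hae] with x hx
    exact (hlim x hx).mul_const _

/-- `T_a ∈ OpS^m_{1,1}` maps `F_∞^{m,1}` into `bmo`. -/
theorem statement2 (d : ℕ) (hd : 1 ≤ d) (m : ℝ)
    (D : LPData d) (a : RD d → RD d → ℂ) (ha : IsSymbolS11 d m a) :
    ∃ C : ℝ≥0, ∀ u : TD d, FinftyNormDist D m 1 u ≠ ⊤ →
      ∃ Tf : TD d, ConvergesInSPrime D a u Tf ∧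
        ∃ g : RD d → ℂ, LocallyIntegrable g volume ∧
          (∀ ψ : 𝓢(RD d, ℂ), Tf ψ = ∫ x, g x * ψ x) ∧
          bmoNorm d g ≤ (C : ℝ≥0∞) * FinftyNormDist D m 1 u := by
  set L := 2 * d + 1
  have hL : 2 * d < L := Nat.lt_succ_self _
  obtain ⟨C, hC0, hbound⟩ := ha.exists_smearPiece_bounds D L
  have hconst : ENNReal.ofReal C * largeCubeConst d L + 2 * smallCubeConst d L C ≠ ⊤ :=
    ENNReal.add_ne_top.2 ⟨ENNReal.mul_ne_top ENNReal.ofReal_ne_top (largeCubeConst_ne_top hL),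
      ENNReal.mul_ne_top ENNReal.ofNat_ne_top (smallCubeConst_ne_top hL C)⟩
  refine ⟨(ENNReal.ofReal C * largeCubeConst d L + 2 * smallCubeConst d L C).toNNReal,
    fun u hu => ?_⟩
  have hC := isCarleson_lpWeight D m u hu
  have hfin : ∀ k x, smoothed L k (lpWeight D m u k) x ≠ ⊤ := fun k x =>
    ne_top_of_le_ne_top (ENNReal.mul_ne_top (smoothedConst_ne_top hL) hC.ne_top)
      (hC.smoothed_le_const L k x)
  set S : ℕ → RD d → ℝ≥0∞ := fun k x => smoothed L k (lpWeight D m u k) x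
  set t : ℕ → RD d → ℂ := fun k => smearPiece D D.Φ a u k 0
  set G : RD d → ℝ≥0∞ := fun x => ENNReal.ofReal C * ∑' k, S k x
  have hGm : Measurable G :=
    (Measurable.tsum fun k => measurable_smoothed L k (hC.measurable k)).const_mul _
  have hG : ∫⁻ x, G x * ENNReal.ofReal (((1 + ‖x‖) ^ (d + 1))⁻¹) < ⊤ := by
    simp only [G, mul_assoc]
    rw [lintegral_const_mul' _ _ ENNReal.ofReal_ne_top]
    exact ENNReal.mul_lt_top ENNReal.ofReal_lt_top (hC.lintegral_tsum_smoothed_mul_lt_top hL)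
  have hs : ∀ k σ x, ‖smearPiece D D.Φ a u k σ x‖ₑ ≤ ENNReal.ofReal C * S k x :=
    fun k => (hbound u k (hfin k)).1
  have hsm : ∀ k σ, Measurable (smearPiece D D.Φ a u k σ) := fun k σ =>
    (ha.stronglyMeasurable_smearPiece D D.Φ u k σ).measurable
  have htm : ∀ k, Measurable (t k) := fun k => hsm k 0
  have htG : ∀ x, ‖∑' k, t k x‖ₑ ≤ G x := fun x => by
    refine enorm_tsum_le_tsum_enorm.trans ?_
    simp only [G]
    rw [← ENNReal.tsum_mul_left]
    exact ENNReal.tsum_le_tsum fun k => hs k 0 x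
  obtain ⟨T, hT⟩ := exists_temperedDistribution_eq_integral hG (Measurable.tsum htm) htG
  refine ⟨T, fun ψ => ?_, fun x => ∑' k, t k x,
    hC.locallyIntegrable_tsum hL htm fun k => hs k 0, hT, ?_⟩
  · rw [hT]
    have hpart := ha.pdoPartial_eq_sum D L u hfin
    refine tendsto_integral_mul_schwartz hGm hG (fun N => ?_) (fun N x => ?_) (fun x hx => ?_) ψ
    · rw [funext (hpart N)]
      exact Finset.measurable_fun_sum _ fun k _ => hsm k _
    · rw [hpart N x]
      refine (enorm_sum_le _ _).trans ((Finset.sum_le_sum fun k _ => hs k _ x).trans ?_)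
      rw [← Finset.mul_sum]
      exact mul_le_mul_right (ENNReal.sum_le_tsum _) _
    · simp only [hpart _ x]
      simp only [G] at hx
      rw [← ENNReal.tsum_mul_left] at hx
      refine tendsto_sum_range_of_dominated (ENNReal.summable_toReal hx) (fun N k => ?_)
        fun k => ?_
      · rw [← toReal_enorm]
        exact ENNReal.toReal_mono (ENNReal.mul_ne_top ENNReal.ofReal_ne_top (hfin k x)) (hs k _ x)
      · rw [tendsto_iff_edist_tendsto_0]
        have h0 : Tendsto (fun N : ℕ => C * |((2:ℝ) ^ N)⁻¹| * 2 ^ k) atTop (nhds 0) := by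
          have h1 : Tendsto (fun N : ℕ => ((2:ℝ) ^ N)⁻¹) atTop (nhds 0) :=
            tendsto_inv_atTop_zero.comp (tendsto_pow_atTop_atTop_of_one_lt one_lt_two)
          simpa using (h1.abs.const_mul C).mul_const (2 ^ k)
        have h2 := ENNReal.Tendsto.mul_const (b := S k x) (ENNReal.tendsto_ofReal h0)
          (Or.inr (hfin k x))
        rw [ENNReal.ofReal_zero, zero_mul] at h2
        refine tendsto_of_tendsto_of_tendsto_of_le_of_le tendsto_const_nhds h2
          (fun N => bot_le) fun N => ?_
        rw [edist_eq_enorm_sub]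
        exact (hbound u k (hfin k)).2.1 _ x
  · rw [ENNReal.coe_toNNReal hconst]
    exact hC.bmoNorm_tsum_le hL hC0 htm (fun k => hs k 0) (fun k => (hbound u k (hfin k)).2.2)

end
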